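/- Let d ≥ 1, p ≥ 1 and let h₁, …, h_p : 𝕋^d×ℝ^d → ℝ be bounded continuous functions. Along any family (μ_ε)_{ε>0} with μ_ε → ∞ and μ_ε ε^d → 0 as ε → 0, the random vector (ζ(h₁), …, ζ(h_p)) converges in distribution to a centered Gaussian vector in ℝ^p with covariance matrix Σ_{ij} = ∫_{𝕋^d×ℝ^d} h_i(x,v) h_j(x,v) M(v) dx dv. -/

import Mathlib

open scoped Classical

open MeasureTheory Real Filter Topology

noncomputable section

abbrev Torus (d : ℕ) := Fin d → UnitAddCircle

abbrev Rd (d : ℕ) := EuclideanSpace ℝ (Fin d)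

/-- The Maxwellian density on `ℝ^d`. -/
def Maxw (d : ℕ) (v : Rd d) : ℝ := (2 * π) ^ (-(d : ℝ) / 2) * Real.exp (-‖v‖ ^ 2 / 2)

/-- The hard-sphere exclusion set `𝒟^ε_N`. -/
def excl (d : ℕ) (ε : ℝ) (N : ℕ) : Set (Fin N → Torus d) :=
  {X | ∀ i j, i ≠ j → ε < dist (X i) (X j)}

/-- `I_N(ε) = ∫_{(𝕋^d)^N} ∏_{i<j} 1_{dist > ε}`. -/
def exclInt (d : ℕ) (ε : ℝ) (N : ℕ) : ℝ := (volume (excl d ε N)).toReal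

/-- The grand canonical partition function `𝒵(μ, ε)`. -/
def partFun (d : ℕ) (ε μ : ℝ) : ℝ := ∑' N : ℕ, μ ^ N / N.factorial * exclInt d ε N

/-- The grand canonical phase space `⊔_N (𝕋^d × ℝ^d)^N`. -/
abbrev Phase (d : ℕ) := Σ N : ℕ, (Fin N → Torus d × Rd d)

/-- Density of the `N`-particle sector with respect to Lebesgue measure. -/
def sectorDens (d : ℕ) (ε μ : ℝ) (N : ℕ) (Z : Fin N → Torus d × Rd d) : ℝ :=
  (μ ^ N / N.factorial) * (if (fun i => (Z i).1) ∈ excl d ε N then 1 else 0)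
    * ∏ i, Maxw d (Z i).2

/-- The grand canonical hard-sphere equilibrium measure `ℙ_{ε,μ}`. -/
def gcMeasure (d : ℕ) (ε μ : ℝ) : Measure (Phase d) :=
  (ENNReal.ofReal (partFun d ε μ))⁻¹ •
    Measure.sum fun N =>
      Measure.map (Sigma.mk N)
        (volume.withDensity fun Z => ENNReal.ofReal (sectorDens d ε μ N Z))

/-- The empirical measure `π(h) = μ⁻¹ Σ_i h(z_i)`. -/
def empir (d : ℕ) (μ : ℝ) (h : Torus d × Rd d → ℝ) (ω : Phase d) : ℝ :=
  μ⁻¹ * ∑ i, h (ω.2 i)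

/-- The fluctuation field `ζ(h) = √μ (π(h) - 𝔼[π(h)])`. -/
def fluct (d : ℕ) (ε μ : ℝ) (h : Torus d × Rd d → ℝ) (ω : Phase d) : ℝ :=
  Real.sqrt μ * (empir d μ h ω - ∫ ω', empir d μ h ω' ∂(gcMeasure d ε μ))

end

noncomputable section HardCore

set_option linter.unusedSectionVars false

variable {E : Type*} [MeasurableSpace E]

theorem measurable_sigma_iff {ι γ : Type*} {β : ι → Type*} [∀ a, MeasurableSpace (β a)]
    [MeasurableSpace γ] {f : Sigma β → γ} :
    Measurable f ↔ ∀ a, Measurable fun x => f ⟨a, x⟩ := by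
  constructor
  · intro hf a s hs
    exact (MeasurableSpace.measurableSet_iInf.1 (hf hs)) a
  · intro hf s hs
    exact MeasurableSpace.measurableSet_iInf.2 fun a => hf a hs

theorem measurable_sigmaMk {ι : Type*} {β : ι → Type*} [∀ a, MeasurableSpace (β a)] (a : ι) :
    Measurable (Sigma.mk a : β a → Sigma β) :=
  measurable_sigma_iff.1 measurable_id a

/-- The `N`-tuples none of whose pairs of entries is related by `R`. -/
def pairAvoiding (R : E → E → Prop) (N : ℕ) : Set (Fin N → E) :=
  {Z | ∀ i j, i ≠ j → ¬ R (Z i) (Z j)}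

/-- The unnormalised grand canonical measure with hard-core exclusion relation `R`, reference
measure `m` and activity `μ`. -/
def hardCore (m : Measure E) (R : E → E → Prop) (μ : ℝ) : Measure (Σ N : ℕ, (Fin N → E)) :=
  Measure.sum fun N => ENNReal.ofReal (μ ^ N / N.factorial) •
    ((Measure.pi fun _ => m).restrict (pairAvoiding R N)).map (Sigma.mk N)

theorem measurableSet_pairAvoiding {R : E → E → Prop} (hR : MeasurableSet {q : E × E | R q.1 q.2})
    (N : ℕ) : MeasurableSet (pairAvoiding R N) := by
  simp only [pairAvoiding, Set.ofPred_forall]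
  refine MeasurableSet.iInter fun i => MeasurableSet.iInter fun j => MeasurableSet.iInter fun _ => ?_
  have h : Measurable fun Z : Fin N → E => (Z i, Z j) := by fun_prop
  exact (h hR).compl

variable {m : Measure E} [IsProbabilityMeasure m] {R : E → E → Prop} {μ : ℝ}

theorem hardCore_ae (hR : MeasurableSet {q : E × E | R q.1 q.2}) :
    ∀ᵐ ω ∂(hardCore m R μ), ω.2 ∈ pairAvoiding R ω.1 := by
  rw [hardCore, Measure.ae_sum_iff]
  intro N
  refine Measure.ae_smul_measure ?_ _
  have hs : MeasurableSet {ω : Σ N : ℕ, (Fin N → E) | ω.2 ∈ pairAvoiding R ω.1} :=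
    MeasurableSpace.measurableSet_iInf.2 fun a => measurableSet_pairAvoiding hR a
  rw [ae_map_iff (measurable_sigmaMk N).aemeasurable hs]
  exact ae_restrict_mem (measurableSet_pairAvoiding hR N)

theorem lintegral_hardCore {f : (Σ N : ℕ, (Fin N → E)) → ENNReal} (hf : Measurable f) :
    ∫⁻ ω, f ω ∂(hardCore m R μ) = ∑' N : ℕ, ENNReal.ofReal (μ ^ N / N.factorial) *
      ∫⁻ Z in pairAvoiding R N, f ⟨N, Z⟩ ∂(Measure.pi fun _ => m) := by
  rw [hardCore, lintegral_sum_measure]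
  refine tsum_congr fun N => ?_
  rw [lintegral_smul_measure, lintegral_map hf (measurable_sigmaMk N), smul_eq_mul]

theorem hasSum_integral_hardCore (hμ : 0 ≤ μ) {f : (Σ N : ℕ, (Fin N → E)) → ℂ} (hfm : Measurable f)
    (hf : Integrable f (hardCore m R μ)) :
    HasSum (fun N : ℕ => ((μ ^ N / N.factorial : ℝ) : ℂ) *
      ∫ Z in pairAvoiding R N, f ⟨N, Z⟩ ∂(Measure.pi fun _ => m)) (∫ ω, f ω ∂(hardCore m R μ)) := by
  have := hasSum_integral_measure hf
  convert! this using 2 with N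
  rw [integral_smul_measure, integral_map (measurable_sigmaMk N).aemeasurable
    hfm.aestronglyMeasurable, ENNReal.toReal_ofReal (by positivity), Complex.real_smul]

theorem lintegral_card_hardCore_lt_top (hμ : 0 ≤ μ) :
    ∫⁻ ω, (ω.1 + 1 : ENNReal) ∂(hardCore m R μ) < ⊤ := by
  rw [lintegral_hardCore (measurable_sigma_iff.2 fun a => by simp)]
  have hs : Summable fun N : ℕ => μ ^ N / N.factorial * ((N : ℝ) + 1) := by
    have h1 := Real.summable_pow_div_factorial (2 * μ)
    refine Summable.of_nonneg_of_le (fun N => by positivity) (fun N => ?_) h1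
    rw [mul_pow, mul_comm, mul_div_assoc]
    gcongr
    exact_mod_cast Nat.lt_two_pow_self (n := N)
  refine lt_of_le_of_lt ?_ (lt_top_iff_ne_top.2 hs.tsum_ofReal_ne_top)
  refine ENNReal.tsum_le_tsum fun N => ?_
  rw [ENNReal.ofReal_mul (by positivity)]
  gcongr
  dsimp only
  rw [setLIntegral_const, ENNReal.ofReal_add (by positivity) (by positivity)]
  simp only [ENNReal.ofReal_natCast, ENNReal.ofReal_one]
  calc _ ≤ ((N : ENNReal) + 1) * 1 := by gcongr; exact prob_le_one
    _ = _ := mul_one _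

theorem isFiniteMeasure_hardCore (hμ : 0 ≤ μ) : IsFiniteMeasure (hardCore m R μ) := by
  refine ⟨?_⟩
  rw [← lintegral_one]
  refine lt_of_le_of_lt ?_ (lintegral_card_hardCore_lt_top (m := m) (R := R) hμ)
  exact lintegral_mono fun ω => by simp

theorem integrable_of_le_card (hμ : 0 ≤ μ) {f : (Σ N : ℕ, (Fin N → E)) → ℂ} (hfm : Measurable f)
    (C : ℝ) (hf : ∀ ω, ‖f ω‖ ≤ C * (ω.1 + 1)) : Integrable f (hardCore m R μ) := by
  have h1 : Integrable (fun ω : (Σ N : ℕ, (Fin N → E)) => ((ω.1 : ℝ) + 1)) (hardCore m R μ) := by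
    refine ⟨(measurable_sigma_iff.2 fun a => by simp).aestronglyMeasurable, ?_⟩
    refine lt_of_le_of_lt (le_of_eq ?_) (lintegral_card_hardCore_lt_top (m := m) (R := R) hμ)
    refine lintegral_congr fun ω => ?_
    rw [Real.enorm_of_nonneg (by positivity), ENNReal.ofReal_add (by positivity) (by positivity)]
    simp
  exact (h1.const_mul C).mono' hfm.aestronglyMeasurable (ae_of_all _ hf)

/-- The generating functional of the hard-core measure. -/
def genFun (m : Measure E) (R : E → E → Prop) (μ : ℝ) (g : E → ℂ) : ℂ :=
  ∫ ω, ∏ i, g (ω.2 i) ∂(hardCore m R μ)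

theorem measurable_prod_apply {g : E → ℂ} (hg : Measurable g) :
    Measurable fun ω : (Σ N : ℕ, (Fin N → E)) => ∏ i, g (ω.2 i) :=
  measurable_sigma_iff.2 fun a => by
    change Measurable fun Z : Fin a → E => ∏ i : Fin a, g (Z i)
    fun_prop

theorem norm_prod_le_one {ι : Type*} (s : Finset ι) {g : E → ℂ} (hg : ∀ z, ‖g z‖ ≤ 1) (Z : ι → E) :
    ‖∏ i ∈ s, g (Z i)‖ ≤ 1 := by
  rw [norm_prod]
  exact Finset.prod_le_one (fun _ _ => norm_nonneg _) fun _ _ => hg _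

theorem integrable_prod (hμ : 0 ≤ μ) {g : E → ℂ} (hg : Measurable g) (hg1 : ∀ z, ‖g z‖ ≤ 1) :
    Integrable (fun ω : (Σ N : ℕ, (Fin N → E)) => ∏ i, g (ω.2 i)) (hardCore m R μ) := by
  refine integrable_of_le_card hμ (measurable_prod_apply hg) 1 fun ω => ?_
  refine (norm_prod_le_one _ hg1 _).trans ?_
  simp

theorem setIntegral_insert (hR : MeasurableSet {q : E × E | R q.1 q.2}) (hsymm : ∀ x y, R x y → R y x)
    {u v : E → ℂ} (hu : Measurable u) (hv : Measurable v) {B : ℝ}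
    (huB : ∀ z, ‖u z‖ ≤ B) (hv1 : ∀ z, ‖v z‖ ≤ 1) (n : ℕ) (i : Fin (n + 1)) :
    ∫ Z in pairAvoiding R (n + 1), u (Z i) * ∏ j ∈ Finset.univ.erase i, v (Z j)
        ∂(Measure.pi fun _ => m) =
      ∫ z, u z * ∫ Z in pairAvoiding R n, ∏ j, ({w | ¬ R z w}.indicator v) (Z j)
        ∂(Measure.pi fun _ => m) ∂m := by
  have hmp := (measurePreserving_piFinSuccAbove (fun _ : Fin (n + 1) => m) i).symm
  rw [← integral_indicator (measurableSet_pairAvoiding hR _), ← hmp.integral_comp']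
  have key : ∀ q : E × (Fin n → E),
      (pairAvoiding R (n + 1)).indicator
        (fun Z => u (Z i) * ∏ j ∈ Finset.univ.erase i, v (Z j))
        ((MeasurableEquiv.piFinSuccAbove (fun _ : Fin (n + 1) => E) i).symm q) =
      u q.1 * (pairAvoiding R n).indicator
        (fun Z => ∏ j, ({w | ¬ R q.1 w}.indicator v) (Z j)) q.2 := by
    rintro ⟨z, Z⟩
    have e1 : ((MeasurableEquiv.piFinSuccAbove (fun _ : Fin (n + 1) => E) i).symm (z, Z)) =
      i.insertNth (α := fun _ => E) z Z := rfl
    rw [e1]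
    have e2 : Finset.univ.erase i = Finset.univ.map (Fin.succAboveEmb i) := by
      rw [Fin.univ_succAbove n i, Finset.erase_cons]
    have hmem : i.insertNth (α := fun _ => E) z Z ∈ pairAvoiding R (n + 1) ↔
        (Z ∈ pairAvoiding R n ∧ ∀ j, ¬ R z (Z j)) := by
      simp only [pairAvoiding, Set.mem_ofPred_eq]
      constructor
      · intro h
        refine ⟨fun j k hjk => ?_, fun j => ?_⟩
        · simpa using h (i.succAbove j) (i.succAbove k) (by simpa using hjk)
        · simpa using h i (i.succAbove j) (Fin.ne_succAbove i j)
      · rintro ⟨h1, h2⟩ j k hjk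
        rcases Fin.eq_self_or_eq_succAbove i j with rfl | ⟨j', rfl⟩
        · rcases Fin.eq_self_or_eq_succAbove j k with rfl | ⟨k', rfl⟩
          · exact absurd rfl hjk
          · simpa using h2 k'
        · rcases Fin.eq_self_or_eq_succAbove i k with rfl | ⟨k', rfl⟩
          · simpa using fun h => h2 j' (hsymm _ _ h)
          · simpa using h1 j' k' (by rintro rfl; exact hjk rfl)
    by_cases hZ : Z ∈ pairAvoiding R n
    · by_cases hz : ∀ j, ¬ R z (Z j)
      · rw [Set.indicator_of_mem (hmem.2 ⟨hZ, hz⟩), Set.indicator_of_mem hZ, e2, Finset.prod_map]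
        simp only [Fin.insertNth_apply_same, Fin.coe_succAboveEmb, Fin.insertNth_apply_succAbove]
        congr 1
        refine Finset.prod_congr rfl fun j _ => ?_
        rw [Set.indicator_of_mem]
        exact hz j
      · rw [Set.indicator_of_notMem (fun h => hz (hmem.1 h).2), Set.indicator_of_mem hZ]
        push Not at hz
        obtain ⟨j, hj⟩ := hz
        rw [Finset.prod_eq_zero (Finset.mem_univ j), mul_zero]
        rw [Set.indicator_of_notMem]
        simpa using hj
    · rw [Set.indicator_of_notMem (fun h => hZ (hmem.1 h).1), Set.indicator_of_notMem hZ, mul_zero]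
  simp_rw [key]
  rw [integral_prod]
  · refine integral_congr_ae (ae_of_all _ fun z => ?_)
    simp only
    rw [integral_const_mul, integral_indicator (measurableSet_pairAvoiding hR _)]
  · simp_rw [← key]
    rw [← Function.comp_def, hmp.integrable_comp_emb (MeasurableEquiv.measurableEmbedding _)]
    refine Integrable.indicator ?_ (measurableSet_pairAvoiding hR _)
    refine Integrable.of_bound (C := B) (Measurable.aestronglyMeasurable (by fun_prop))
      (ae_of_all _ fun Z => ?_)
    rw [norm_mul]
    have := norm_prod_le_one (Finset.univ.erase i) hv1 Z
    nlinarith [huB (Z i), norm_nonneg (u (Z i)), norm_nonneg (∏ j ∈ Finset.univ.erase i, v (Z j))]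

theorem measurable_integral_avoid (hR : MeasurableSet {q : E × E | R q.1 q.2}) {v : E → ℂ}
    (hv : Measurable v) (n : ℕ) :
    Measurable fun z => ∫ Z in pairAvoiding R n, ∏ j, ({w | ¬ R z w}.indicator v) (Z j)
      ∂(Measure.pi fun _ => m) := by
  have h1 : Measurable ({q : E × E | R q.1 q.2}ᶜ.indicator fun q => v q.2) :=
    (hv.comp measurable_snd).indicator hR.compl
  have h2 : Measurable fun q : E × (Fin n → E) => ∏ j, ({w | ¬ R q.1 w}.indicator v) (q.2 j) := by
    refine Finset.measurable_fun_prod _ fun j _ => ?_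
    exact h1.comp (f := fun q : E × (Fin n → E) => (q.1, q.2 j)) (by fun_prop)
  exact (StronglyMeasurable.integral_prod_right' h2.stronglyMeasurable).measurable

theorem norm_indicator_le_one {g : E → ℂ} (hg : ∀ z, ‖g z‖ ≤ 1) (s : Set E) (z : E) :
    ‖s.indicator g z‖ ≤ 1 :=
  (norm_indicator_le_norm_self _ _).trans (hg z)

theorem hasSum_genFun (hμ : 0 ≤ μ) {g : E → ℂ} (hg : Measurable g) (hg1 : ∀ z, ‖g z‖ ≤ 1) :
    HasSum (fun N : ℕ => ((μ ^ N / N.factorial : ℝ) : ℂ) *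
      ∫ Z in pairAvoiding R N, ∏ i, g (Z i) ∂(Measure.pi fun _ => m)) (genFun m R μ g) := by
  have h := hasSum_integral_hardCore hμ (measurable_prod_apply hg)
    (integrable_prod (m := m) (R := R) hμ hg hg1)
  exact h

theorem measurableSet_not_rel (hR : MeasurableSet {q : E × E | R q.1 q.2}) (z : E) :
    MeasurableSet {w | ¬ R z w} := by
  have h : Measurable fun w : E => (z, w) := by fun_prop
  exact (h hR).compl

theorem measurable_genFun_avoid (hμ : 0 ≤ μ) (hR : MeasurableSet {q : E × E | R q.1 q.2})
    {v : E → ℂ} (hv : Measurable v) (hv1 : ∀ z, ‖v z‖ ≤ 1) :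
    Measurable fun z => genFun m R μ ({w | ¬ R z w}.indicator v) := by
  refine measurable_of_tendsto_metrizable (f := fun (n : ℕ) z => ∑ N ∈ Finset.range n,
    ((μ ^ N / N.factorial : ℝ) : ℂ) * ∫ Z in pairAvoiding R N,
      ∏ j, ({w | ¬ R z w}.indicator v) (Z j) ∂(Measure.pi fun _ => m)) (fun n => ?_) ?_
  · exact Finset.measurable_fun_sum _ fun N _ => (measurable_integral_avoid hR hv N).const_mul _
  · rw [tendsto_pi_nhds]
    intro z
    exact (hasSum_genFun hμ (hv.indicator (measurableSet_not_rel hR z))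
      (norm_indicator_le_one hv1 _)).tendsto_sum_nat

theorem norm_setIntegral_le_one {n : ℕ} {g : E → ℂ} (hg : ∀ z, ‖g z‖ ≤ 1) (s : Set (Fin n → E)) :
    ‖∫ Z in s, ∏ j, g (Z j) ∂(Measure.pi fun _ => m)‖ ≤ 1 := by
  refine (norm_setIntegral_le_of_norm_le_const (C := 1) (measure_lt_top _ _)
    (fun Z _ => norm_prod_le_one _ hg Z)).trans ?_
  rw [one_mul]
  exact measureReal_le_one

theorem measurable_sum_erase {u v : E → ℂ} (hu : Measurable u) (hv : Measurable v) :
    Measurable fun ω : (Σ N : ℕ, (Fin N → E)) =>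
      ∑ i, u (ω.2 i) * ∏ j ∈ Finset.univ.erase i, v (ω.2 j) :=
  measurable_sigma_iff.2 fun a => by
    change Measurable fun Z : Fin a → E =>
      ∑ i : Fin a, u (Z i) * ∏ j ∈ Finset.univ.erase i, v (Z j)
    fun_prop

theorem norm_sum_erase_le {u v : E → ℂ} {B : ℝ} (huB : ∀ z, ‖u z‖ ≤ B) (hv1 : ∀ z, ‖v z‖ ≤ 1)
    (hB : 0 ≤ B) (ω : Σ N : ℕ, (Fin N → E)) :
    ‖∑ i, u (ω.2 i) * ∏ j ∈ Finset.univ.erase i, v (ω.2 j)‖ ≤ B * (ω.1 + 1) := by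
  have h : ∀ i ∈ Finset.univ, ‖u (ω.2 i) * ∏ j ∈ Finset.univ.erase i, v (ω.2 j)‖ ≤ B := by
    intro i _
    rw [norm_mul]
    have := norm_prod_le_one (Finset.univ.erase i) hv1 ω.2
    nlinarith [huB (ω.2 i), norm_nonneg (u (ω.2 i)),
      norm_nonneg (∏ j ∈ Finset.univ.erase i, v (ω.2 j))]
  refine (norm_sum_le_of_le _ h).trans ?_
  simp only [Finset.sum_const, Finset.card_univ, Fintype.card_fin, nsmul_eq_mul]
  nlinarith

theorem integrable_sum_erase (hμ : 0 ≤ μ) {u v : E → ℂ} (hu : Measurable u) (hv : Measurable v)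
    {B : ℝ} (huB : ∀ z, ‖u z‖ ≤ B) (hv1 : ∀ z, ‖v z‖ ≤ 1) (hB : 0 ≤ B) :
    Integrable (fun ω : (Σ N : ℕ, (Fin N → E)) =>
      ∑ i, u (ω.2 i) * ∏ j ∈ Finset.univ.erase i, v (ω.2 j)) (hardCore m R μ) :=
  integrable_of_le_card hμ (measurable_sum_erase hu hv) B (norm_sum_erase_le huB hv1 hB)

/-- The Georgii–Nguyen–Zessin equation for multiplicative functionals. -/
theorem integral_sum_erase (hμ : 0 ≤ μ) (hR : MeasurableSet {q : E × E | R q.1 q.2})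
    (hsymm : ∀ x y, R x y → R y x) {u v : E → ℂ} (hu : Measurable u) (hv : Measurable v)
    {B : ℝ} (huB : ∀ z, ‖u z‖ ≤ B) (hv1 : ∀ z, ‖v z‖ ≤ 1) (hB : 0 ≤ B) :
    ∫ ω, ∑ i, u (ω.2 i) * ∏ j ∈ Finset.univ.erase i, v (ω.2 j) ∂(hardCore m R μ) =
      μ * ∫ z, u z * genFun m R μ ({w | ¬ R z w}.indicator v) ∂m := by
  have h1 := hasSum_integral_hardCore hμ (measurable_sum_erase hu hv)
    (integrable_sum_erase (m := m) (R := R) hμ hu hv huB hv1 hB)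
  set J : ℕ → E → ℂ := fun N z => ∫ Z in pairAvoiding R N,
    ∏ j, ({w | ¬ R z w}.indicator v) (Z j) ∂(Measure.pi fun _ => m) with hJ
  have hJm : ∀ N, Measurable (J N) := fun N => measurable_integral_avoid hR hv N
  have hJ1 : ∀ N z, ‖J N z‖ ≤ 1 := fun N z =>
    norm_setIntegral_le_one (norm_indicator_le_one hv1 _) _
  have hFb : ∀ (N : ℕ) z, ‖u z * (((μ ^ N / N.factorial : ℝ) : ℂ) * J N z)‖ ≤
      B * (μ ^ N / N.factorial) := by
    intro N z
    have h0 : 0 ≤ μ ^ N / (N.factorial : ℝ) := by positivity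
    rw [norm_mul, norm_mul, Complex.norm_real, Real.norm_of_nonneg h0]
    refine mul_le_mul (huB z) ?_ (by positivity) hB
    exact mul_le_of_le_one_right h0 (hJ1 N z)
  have hFi : ∀ N : ℕ, Integrable
      (fun z => u z * (((μ ^ N / N.factorial : ℝ) : ℂ) * J N z)) m := fun N =>
    Integrable.of_bound (hu.mul ((hJm N).const_mul _)).aestronglyMeasurable _
      (ae_of_all _ (hFb N))
  have hsum := Real.summable_pow_div_factorial μ
  have h2 := hasSum_integral_of_summable_integral_norm hFi (by
    refine Summable.of_nonneg_of_le (fun N => integral_nonneg fun z => norm_nonneg _)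
      (fun N => ?_) (hsum.mul_left B)
    refine (integral_mono (hFi N).norm (integrable_const _) (hFb N)).trans ?_
    simp)
  have h3 : ∀ z, ∑' N : ℕ, u z * (((μ ^ N / N.factorial : ℝ) : ℂ) * J N z) =
      u z * genFun m R μ ({w | ¬ R z w}.indicator v) := by
    intro z
    exact ((hasSum_genFun hμ (hv.indicator (measurableSet_not_rel hR z))
      (norm_indicator_le_one hv1 _)).mul_left (u z)).tsum_eq
  simp_rw [h3] at h2
  have h4 := h2.mul_left (μ : ℂ)
  refine h1.unique ?_
  rw [← hasSum_nat_add_iff' 1]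
  simp only [Finset.range_one, Finset.sum_singleton, Finset.univ_eq_empty, Finset.sum_empty,
    integral_zero, mul_zero, sub_zero]
  convert! h4 using 2 with N
  have hint : ∀ i : Fin (N + 1), Integrable (fun Z : Fin (N + 1) → E =>
      u (Z i) * ∏ j ∈ Finset.univ.erase i, v (Z j))
      ((Measure.pi fun _ => m).restrict (pairAvoiding R (N + 1))) := by
    intro i
    refine Integrable.of_bound (C := B) (Measurable.aestronglyMeasurable (by fun_prop))
      (ae_of_all _ fun Z => ?_)
    rw [norm_mul]
    have := norm_prod_le_one (Finset.univ.erase i) hv1 Z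
    nlinarith [huB (Z i), norm_nonneg (u (Z i)), norm_nonneg (∏ j ∈ Finset.univ.erase i, v (Z j))]
  change _ * ∫ Z in pairAvoiding R (N + 1), ∑ i : Fin (N + 1),
    u (Z i) * ∏ j ∈ Finset.univ.erase i, v (Z j) ∂(Measure.pi fun _ => m) = _
  rw [integral_finsetSum _ fun i _ => hint i]
  simp_rw [setIntegral_insert hR hsymm hu hv huB hv1]
  have h5 : ∫ z, u z * (((μ ^ N / N.factorial : ℝ) : ℂ) * J N z) ∂m =
      ((μ ^ N / N.factorial : ℝ) : ℂ) * ∫ z, u z * J N z ∂m := by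
    rw [← integral_const_mul]
    exact integral_congr_ae (ae_of_all _ fun z => by ring)
  rw [h5, Finset.sum_const, Finset.card_univ, Fintype.card_fin, Nat.factorial_succ, nsmul_eq_mul]
  push_cast
  have : (N : ℂ) + 1 ≠ 0 := by exact_mod_cast N.succ_ne_zero
  have : (N.factorial : ℂ) ≠ 0 := by exact_mod_cast N.factorial_ne_zero
  field_simp
  simp only [hJ]
  ring

/-- Expansion of the generating functional according to the unique particle in a set `S` that can
contain at most one of them. -/
theorem genFun_eq_add (hμ : 0 ≤ μ) (hR : MeasurableSet {q : E × E | R q.1 q.2})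
    (hsymm : ∀ x y, R x y → R y x) {v : E → ℂ} (hv : Measurable v) (hv1 : ∀ z, ‖v z‖ ≤ 1)
    {S : Set E} (hS : MeasurableSet S) (hclique : ∀ x ∈ S, ∀ y ∈ S, R x y) :
    genFun m R μ v = genFun m R μ (Sᶜ.indicator v) +
      μ * ∫ z, S.indicator v z * genFun m R μ ({w | ¬ R z w}.indicator v) ∂m := by
  have hu := norm_indicator_le_one hv1 S
  rw [← integral_sum_erase hμ hR hsymm (hv.indicator hS) hv hu hv1 zero_le_one, genFun, genFun,
    ← integral_add (integrable_prod hμ (hv.indicator hS.compl) (norm_indicator_le_one hv1 _))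
      (integrable_sum_erase hμ (hv.indicator hS) hv hu hv1 zero_le_one)]
  refine integral_congr_ae ?_
  filter_upwards [hardCore_ae hR] with ω hω
  by_cases h : ∃ i, ω.2 i ∈ S
  · obtain ⟨i, hi⟩ := h
    have hne : ∀ j, j ≠ i → ω.2 j ∉ S := fun j hj hjS => hω j i hj (hclique _ hjS _ hi)
    rw [Finset.prod_eq_zero (f := fun i => Sᶜ.indicator v (ω.2 i)) (Finset.mem_univ i)
      (Set.indicator_of_notMem (by simpa using hi) _), zero_add,
      Finset.sum_eq_single i (fun j _ hj => by rw [Set.indicator_of_notMem (hne j hj), zero_mul])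
        (fun h => absurd (Finset.mem_univ i) h), Set.indicator_of_mem hi,
      Finset.mul_prod_erase _ (fun j => v (ω.2 j)) (Finset.mem_univ i)]
  · push Not at h
    rw [Finset.sum_eq_zero (fun i _ => by rw [Set.indicator_of_notMem (h i), zero_mul]), add_zero]
    exact Finset.prod_congr rfl fun i _ => (Set.indicator_of_mem (h i) _).symm

/-- The unnormalised probability that all particles lie in `Λ`. -/
def confined (m : Measure E) (R : E → E → Prop) (μ : ℝ) (Λ : Set E) : ℝ :=
  (hardCore m R μ).real {ω | ∀ i, ω.2 i ∈ Λ}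

theorem measurableSet_forall_mem {Λ : Set E} (hΛ : MeasurableSet Λ) :
    MeasurableSet {ω : (Σ N : ℕ, (Fin N → E)) | ∀ i, ω.2 i ∈ Λ} := by
  refine MeasurableSpace.measurableSet_iInf.2 fun a => ?_
  change MeasurableSet {Z : Fin a → E | ∀ i : Fin a, Z i ∈ Λ}
  rw [Set.ofPred_forall]
  exact MeasurableSet.iInter fun i => measurable_pi_apply i hΛ

theorem prod_indicator_one (Λ : Set E) (ω : Σ N : ℕ, (Fin N → E)) :
    ∏ i, Λ.indicator (1 : E → ℂ) (ω.2 i) =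
      {ω : (Σ N : ℕ, (Fin N → E)) | ∀ i, ω.2 i ∈ Λ}.indicator 1 ω := by
  by_cases h : ∀ i, ω.2 i ∈ Λ
  · rw [Set.indicator_of_mem (show ω ∈ {ω : (Σ N : ℕ, (Fin N → E)) | ∀ i, ω.2 i ∈ Λ} from h)]
    exact Finset.prod_eq_one fun i _ => Set.indicator_of_mem (h i) _
  · rw [Set.indicator_of_notMem (show ω ∉ {ω : (Σ N : ℕ, (Fin N → E)) | ∀ i, ω.2 i ∈ Λ} from h)]
    push Not at h
    obtain ⟨i, hi⟩ := h
    exact Finset.prod_eq_zero (Finset.mem_univ i) (Set.indicator_of_notMem hi _)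

theorem genFun_indicator_one {Λ : Set E} (hΛ : MeasurableSet Λ) :
    genFun m R μ (Λ.indicator 1) = confined m R μ Λ := by
  simp_rw [genFun, prod_indicator_one]
  rw [integral_indicator (measurableSet_forall_mem hΛ)]
  simp [confined]

theorem confined_mono (hμ : 0 ≤ μ) {Λ Λ' : Set E} (h : Λ ⊆ Λ') :
    confined m R μ Λ ≤ confined m R μ Λ' := by
  have := isFiniteMeasure_hardCore (m := m) (R := R) hμ
  exact measureReal_mono fun ω hω i => h (hω i)

theorem confined_pos (hμ : 0 ≤ μ) {Λ : Set E} (hΛ : MeasurableSet Λ) :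
    0 < confined m R μ Λ := by
  have := isFiniteMeasure_hardCore (m := m) (R := R) hμ
  rw [confined, measureReal_def, ENNReal.toReal_pos_iff]
  refine ⟨?_, measure_lt_top _ _⟩
  have h := Measure.le_sum (fun N : ℕ => ENNReal.ofReal (μ ^ N / N.factorial) •
    ((Measure.pi fun _ => m).restrict (pairAvoiding R N)).map
      (Sigma.mk (β := fun N => Fin N → E) N)) 0
    {ω | ∀ i, ω.2 i ∈ Λ}
  refine lt_of_lt_of_le ?_ h
  rw [Measure.smul_apply, Measure.map_apply (measurable_sigmaMk 0) (measurableSet_forall_mem hΛ)]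
  have h1 : (Sigma.mk (β := fun N => Fin N → E) 0) ⁻¹' {ω | ∀ i, ω.2 i ∈ Λ} =
      Set.univ := Set.eq_univ_of_forall fun Z i => i.elim0
  have h2 : pairAvoiding R 0 = Set.univ := Set.eq_univ_of_forall fun Z i => i.elim0
  rw [h1, h2]
  simp

theorem norm_genFun_indicator_le (hμ : 0 ≤ μ) {g : E → ℂ} (hg1 : ∀ z, ‖g z‖ ≤ 1)
    {Λ : Set E} (hΛ : MeasurableSet Λ) :
    ‖genFun m R μ (Λ.indicator g)‖ ≤ confined m R μ Λ := by
  have := isFiniteMeasure_hardCore (m := m) (R := R) hμ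
  rw [confined, ← integral_indicator_one (measurableSet_forall_mem hΛ), genFun]
  refine norm_integral_le_of_norm_le
    ((integrable_const (1 : ℝ)).indicator (measurableSet_forall_mem hΛ)) (ae_of_all _ fun ω => ?_)
  by_cases h : ∀ i, ω.2 i ∈ Λ
  · rw [Set.indicator_of_mem (show ω ∈ {ω : (Σ N : ℕ, (Fin N → E)) | ∀ i, ω.2 i ∈ Λ} from h)]
    exact norm_prod_le_one _ (norm_indicator_le_one hg1 _) _
  · rw [Set.indicator_of_notMem (show ω ∉ {ω : (Σ N : ℕ, (Fin N → E)) | ∀ i, ω.2 i ∈ Λ} from h)]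
    push Not at h
    obtain ⟨i, hi⟩ := h
    rw [Finset.prod_eq_zero (Finset.mem_univ i) (Set.indicator_of_notMem hi _), norm_zero]

/-- The expectation of a multiplicative functional under the hard-core measure confined to `Λ`. -/
def ratio (m : Measure E) (R : E → E → Prop) (μ : ℝ) (g : E → ℂ) (Λ : Set E) : ℂ :=
  genFun m R μ (Λ.indicator g) / confined m R μ Λ

theorem norm_ratio_le_one (hμ : 0 ≤ μ) {g : E → ℂ} (hg1 : ∀ z, ‖g z‖ ≤ 1)
    {Λ : Set E} (hΛ : MeasurableSet Λ) : ‖ratio m R μ g Λ‖ ≤ 1 := by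
  have h := confined_pos (m := m) (R := R) hμ hΛ
  rw [ratio, norm_div, Complex.norm_real, Real.norm_of_nonneg h.le, div_le_one h]
  exact norm_genFun_indicator_le hμ hg1 hΛ

theorem ratio_mul_confined (hμ : 0 ≤ μ) (g : E → ℂ) {Λ : Set E} (hΛ : MeasurableSet Λ) :
    ratio m R μ g Λ * confined m R μ Λ = genFun m R μ (Λ.indicator g) := by
  rw [ratio, div_mul_cancel₀]
  exact_mod_cast (confined_pos hμ hΛ).ne'

theorem genFun_indicator_eq_add (hμ : 0 ≤ μ) (hR : MeasurableSet {q : E × E | R q.1 q.2})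
    (hsymm : ∀ x y, R x y → R y x) {g : E → ℂ} (hg : Measurable g) (hg1 : ∀ z, ‖g z‖ ≤ 1)
    {S Λ : Set E} (hS : MeasurableSet S) (hclique : ∀ x ∈ S, ∀ y ∈ S, R x y)
    (hΛ : MeasurableSet Λ) :
    genFun m R μ (Λ.indicator g) = genFun m R μ ((Sᶜ ∩ Λ).indicator g) +
      μ * ∫ z, (S ∩ Λ).indicator g z * genFun m R μ (({w | ¬ R z w} ∩ Λ).indicator g) ∂m := by
  simp_rw [← Set.indicator_indicator]
  exact genFun_eq_add hμ hR hsymm (hg.indicator hΛ) (norm_indicator_le_one hg1 _) hS hclique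

theorem integrable_indicator_mul_genFun (hμ : 0 ≤ μ) (hR : MeasurableSet {q : E × E | R q.1 q.2})
    {g u : E → ℂ} (hg : Measurable g) (hg1 : ∀ z, ‖g z‖ ≤ 1) (hu : Measurable u) {B : ℝ}
    (hu1 : ∀ z, ‖u z‖ ≤ B) {Λ : Set E} (hΛ : MeasurableSet Λ) :
    Integrable (fun z => u z * genFun m R μ (({w | ¬ R z w} ∩ Λ).indicator g)) m := by
  simp_rw [← Set.indicator_indicator]
  refine Integrable.of_bound (C := B * confined m R μ Λ) (hu.mul (measurable_genFun_avoid hμ hR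
    (hg.indicator hΛ) (norm_indicator_le_one hg1 _))).aestronglyMeasurable (ae_of_all _ fun z => ?_)
  rw [norm_mul, Set.indicator_indicator]
  exact mul_le_mul (hu1 z) ((norm_genFun_indicator_le hμ hg1
    ((measurableSet_not_rel hR z).inter hΛ)).trans (confined_mono hμ Set.inter_subset_right))
    (norm_nonneg _) ((norm_nonneg _).trans (hu1 z))

theorem norm_integral_le_of_support {F : E → ℂ} {S : Set E} (hS : MeasurableSet S) {C : ℝ}
    (h1 : ∀ z ∈ S, ‖F z‖ ≤ C) (h0 : ∀ z ∉ S, F z = 0) : ‖∫ z, F z ∂m‖ ≤ C * m.real S := by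
  have h : ∫ z, F z ∂m = ∫ z in S, F z ∂m := by
    rw [← integral_indicator hS]
    refine integral_congr_ae (ae_of_all _ fun z => ?_)
    by_cases hz : z ∈ S
    · simp [hz]
    · simp [hz, h0 z hz]
  rw [h]
  exact norm_setIntegral_le_of_norm_le_const (measure_lt_top _ _) h1

theorem norm_ratio_sub_le_of_clique (hμ : 0 ≤ μ) (hR : MeasurableSet {q : E × E | R q.1 q.2})
    (hsymm : ∀ x y, R x y → R y x) {g : E → ℂ} (hg : Measurable g) (hg1 : ∀ z, ‖g z‖ ≤ 1)
    {c K : ℝ} (hc : ∀ z, ‖g z - 1‖ ≤ c)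
    (hK : ∀ Λ z, MeasurableSet Λ → ‖ratio m R μ g Λ - ratio m R μ g ({w | ¬ R z w} ∩ Λ)‖ ≤ K)
    {S Λ : Set E} (hS : MeasurableSet S) (hclique : ∀ x ∈ S, ∀ y ∈ S, R x y)
    (hΛ : MeasurableSet Λ) :
    ‖ratio m R μ g Λ - ratio m R μ g (Sᶜ ∩ Λ)‖ ≤ μ * (c + K) * m.real S := by
  have hZ := confined_pos (m := m) (R := R) hμ hΛ
  set e := ratio m R μ g (Sᶜ ∩ Λ) with he
  have hSΛ : MeasurableSet (Sᶜ ∩ Λ) := hS.compl.inter hΛ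
  have hone : ∀ z, ‖(1 : E → ℂ) z‖ ≤ 1 := by simp
  have h1 := genFun_indicator_eq_add (m := m) (R := R) hμ hR hsymm hg hg1 hS hclique hΛ
  have h2 := genFun_indicator_eq_add (m := m) (R := R) hμ hR hsymm (g := 1) measurable_one
    hone hS hclique hΛ
  have hi1 := integrable_indicator_mul_genFun (m := m) (R := R) hμ hR hg hg1
    (hg.indicator (hS.inter hΛ)) (norm_indicator_le_one hg1 (S ∩ Λ)) hΛ
  have hi2 := integrable_indicator_mul_genFun (m := m) (R := R) hμ hR (g := 1) measurable_one
    hone (measurable_one.indicator (hS.inter hΛ)) (norm_indicator_le_one hone (S ∩ Λ)) hΛ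
  rw [genFun_indicator_one hΛ, genFun_indicator_one hSΛ] at h2
  have h3 : genFun m R μ (Λ.indicator g) - e * confined m R μ Λ =
      μ * ∫ z, ((S ∩ Λ).indicator g z * genFun m R μ (({w | ¬ R z w} ∩ Λ).indicator g) -
        e * ((S ∩ Λ).indicator 1 z * genFun m R μ (({w | ¬ R z w} ∩ Λ).indicator 1))) ∂m := by
    rw [integral_sub hi1 (hi2.const_mul e), integral_const_mul, h1, h2,
      ← ratio_mul_confined hμ g hSΛ, ← he]
    ring
  have h4 : ‖∫ z, ((S ∩ Λ).indicator g z * genFun m R μ (({w | ¬ R z w} ∩ Λ).indicator g) -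
        e * ((S ∩ Λ).indicator 1 z * genFun m R μ (({w | ¬ R z w} ∩ Λ).indicator 1))) ∂m‖ ≤
      confined m R μ Λ * (c + K) * m.real S := by
    have hcK : ∀ z, 0 ≤ c + K := fun z =>
      add_nonneg ((norm_nonneg _).trans (hc z)) ((norm_nonneg _).trans (hK Λ z hΛ))
    refine norm_integral_le_of_support hS (fun z hz => ?_) (fun z hz => ?_)
    · by_cases hzΛ : z ∈ Λ
      · have hzS : z ∈ S ∩ Λ := ⟨hz, hzΛ⟩
        rw [Set.indicator_of_mem hzS, Set.indicator_of_mem hzS, Pi.one_apply, one_mul]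
        have hA := (measurableSet_not_rel hR z).inter hΛ
        have hset : {w | ¬ R z w} ∩ Λ = {w | ¬ R z w} ∩ (Sᶜ ∩ Λ) := by
          ext w
          simp only [Set.mem_inter_iff, Set.mem_ofPred_eq, Set.mem_compl_iff]
          exact ⟨fun h => ⟨h.1, fun hw => h.1 (hclique z hz w hw), h.2⟩, fun h => ⟨h.1, h.2.2⟩⟩
        rw [genFun_indicator_one hA, ← ratio_mul_confined hμ g hA, ← mul_assoc, ← sub_mul, norm_mul,
          Complex.norm_real, Real.norm_of_nonneg (confined_pos hμ hA).le, mul_comm]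
        refine mul_le_mul (confined_mono hμ Set.inter_subset_right) ?_ (norm_nonneg _) hZ.le
        have h5 : g z * ratio m R μ g ({w | ¬ R z w} ∩ Λ) - e =
            (g z - 1) * ratio m R μ g ({w | ¬ R z w} ∩ Λ) +
              (ratio m R μ g ({w | ¬ R z w} ∩ Λ) - e) := by ring
        rw [h5]
        refine (norm_add_le _ _).trans (add_le_add ?_ ?_)
        · rw [norm_mul]
          exact (mul_le_of_le_one_right (norm_nonneg _) (norm_ratio_le_one hμ hg1 hA)).trans (hc z)
        · rw [norm_sub_rev, hset]
          exact hK _ z hSΛ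
      · rw [Set.indicator_of_notMem (fun h => hzΛ h.2), Set.indicator_of_notMem (fun h => hzΛ h.2)]
        simp only [zero_mul, mul_zero, sub_zero, norm_zero]
        exact mul_nonneg hZ.le (hcK z)
    · rw [Set.indicator_of_notMem (fun h => hz h.1), Set.indicator_of_notMem (fun h => hz h.1)]
      simp
  have hZ0 : (confined m R μ Λ : ℂ) ≠ 0 := by exact_mod_cast hZ.ne'
  have h6 : ratio m R μ g Λ - e =
      (genFun m R μ (Λ.indicator g) - e * confined m R μ Λ) / confined m R μ Λ := by
    rw [ratio]
    field_simp
  rw [h6, h3, norm_div, norm_mul, Complex.norm_real, Complex.norm_real, Real.norm_of_nonneg hμ,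
    Real.norm_of_nonneg hZ.le, div_le_iff₀ hZ]
  calc _ ≤ μ * (confined m R μ Λ * (c + K) * m.real S) := mul_le_mul_of_nonneg_left h4 hμ
    _ = _ := by ring

theorem norm_confined_sub_le_of_clique (hμ : 0 ≤ μ) (hR : MeasurableSet {q : E × E | R q.1 q.2})
    (hsymm : ∀ x y, R x y → R y x) {S Λ : Set E} (hS : MeasurableSet S)
    (hclique : ∀ x ∈ S, ∀ y ∈ S, R x y) (hΛ : MeasurableSet Λ) :
    ‖(confined m R μ Λ : ℂ) - confined m R μ (Sᶜ ∩ Λ)‖ ≤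
      μ * confined m R μ Set.univ * m.real S := by
  have hone : ∀ z, ‖(1 : E → ℂ) z‖ ≤ 1 := by simp
  have h2 := genFun_indicator_eq_add (m := m) (R := R) hμ hR hsymm (g := 1) measurable_one
    hone hS hclique hΛ
  rw [genFun_indicator_one hΛ, genFun_indicator_one (hS.compl.inter hΛ)] at h2
  rw [h2, add_sub_cancel_left, norm_mul, Complex.norm_real, Real.norm_of_nonneg hμ, mul_assoc]
  refine mul_le_mul_of_nonneg_left (norm_integral_le_of_support hS (fun z _ => ?_) fun z hz => ?_) hμ
  · rw [norm_mul]
    calc _ ≤ 1 * confined m R μ Set.univ := by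
          refine mul_le_mul (norm_indicator_le_one hone _ z) ?_ (norm_nonneg _) zero_le_one
          exact (norm_genFun_indicator_le hμ hone ((measurableSet_not_rel hR z).inter hΛ)).trans
            (confined_mono hμ (Set.subset_univ _))
      _ = _ := one_mul _
  · rw [Set.indicator_of_notMem (fun h => hz h.1), zero_mul]

/-- A bound for the effect of removing cliques extends to arbitrary measurable sets. -/
theorem norm_sub_le_of_cover {f : Set E → ℂ} {C : ℝ}
    (h : ∀ S Λ, MeasurableSet S → (∀ x ∈ S, ∀ y ∈ S, R x y) → MeasurableSet Λ →
      ‖f Λ - f (Sᶜ ∩ Λ)‖ ≤ C * m.real S)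
    (t : Finset (Set E)) (ht : ∀ S ∈ t, MeasurableSet S ∧ ∀ x ∈ S, ∀ y ∈ S, R x y) :
    ∀ T Λ, MeasurableSet T → MeasurableSet Λ → T ⊆ ⋃ S ∈ t, S →
      ‖f Λ - f (Tᶜ ∩ Λ)‖ ≤ C * m.real T := by
  induction t using Finset.induction_on with
  | empty =>
    intro T Λ _ _ hT
    have : T = ∅ := by simpa using hT
    simp [this]
  | insert S t _ ih =>
    intro T Λ hT hΛ hTt
    obtain ⟨hS, hclique⟩ := ht S (Finset.mem_insert_self _ _)
    have h1 := h (T ∩ S) Λ (hT.inter hS) (fun x hx y hy => hclique x hx.2 y hy.2) hΛ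
    have h2 := ih (fun S' hS' => ht S' (Finset.mem_insert_of_mem hS')) (T \ S)
      ((T ∩ S)ᶜ ∩ Λ) (hT.diff hS) ((hT.inter hS).compl.inter hΛ) (by
        intro x hx
        have := hTt hx.1
        simp only [Set.mem_iUnion, Finset.mem_insert, exists_prop] at this ⊢
        obtain ⟨S', rfl | hS', hx'⟩ := this
        · exact absurd hx' hx.2
        · exact ⟨S', hS', hx'⟩)
    have h3 : (T \ S)ᶜ ∩ ((T ∩ S)ᶜ ∩ Λ) = Tᶜ ∩ Λ := by
      ext x
      simp only [Set.mem_inter_iff, Set.mem_compl_iff, Set.mem_sdiff]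
      tauto
    rw [h3] at h2
    rw [← measureReal_inter_add_sdiff hS (s := T), mul_add]
    exact (norm_sub_le_norm_sub_add_norm_sub _ _ _).trans (add_le_add h1 h2)

/-- Decay of correlations: forbidding the neighbourhood of a point hardly changes the expectation
of a multiplicative functional. -/
theorem norm_ratio_sub_avoid_le (hμ : 0 ≤ μ) (hR : MeasurableSet {q : E × E | R q.1 q.2})
    (hsymm : ∀ x y, R x y → R y x)
    (hcover : ∃ t : Finset (Set E), (∀ S ∈ t, MeasurableSet S ∧ ∀ x ∈ S, ∀ y ∈ S, R x y) ∧
      Set.univ ⊆ ⋃ S ∈ t, S)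
    {δ : ℝ} (hδ1 : δ < 1) (hδ : ∀ z, μ * m.real {w | R z w} ≤ δ)
    {g : E → ℂ} (hg : Measurable g) (hg1 : ∀ z, ‖g z‖ ≤ 1) {c : ℝ} (hc : ∀ z, ‖g z - 1‖ ≤ c)
    {Λ : Set E} (hΛ : MeasurableSet Λ) (z : E) :
    ‖ratio m R μ g Λ - ratio m R μ g ({w | ¬ R z w} ∩ Λ)‖ ≤ δ * c / (1 - δ) := by
  obtain ⟨t, ht, htu⟩ := hcover
  have hδ0 : 0 ≤ δ := (mul_nonneg hμ measureReal_nonneg).trans (hδ z)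
  have hc0 : 0 ≤ c := (norm_nonneg _).trans (hc z)
  have hne : 1 - δ ≠ 0 := by linarith
  have key : ∀ n : ℕ, ∀ Λ z, MeasurableSet Λ →
      ‖ratio m R μ g Λ - ratio m R μ g ({w | ¬ R z w} ∩ Λ)‖ ≤ δ * c / (1 - δ) + 2 * δ ^ n := by
    intro n
    induction n with
    | zero =>
      intro Λ z hΛ
      have h1 := norm_ratio_le_one (m := m) (R := R) hμ hg1 hΛ
      have h2 := norm_ratio_le_one (m := m) (R := R) hμ hg1 ((measurableSet_not_rel hR z).inter hΛ)
      have h3 : 0 ≤ δ * c / (1 - δ) := div_nonneg (mul_nonneg hδ0 hc0) (by linarith)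
      refine (norm_sub_le _ _).trans ?_
      linarith
    | succ n ih =>
      intro Λ z hΛ
      have h := norm_sub_le_of_cover (m := m) (R := R) (f := ratio m R μ g)
        (C := μ * (c + (δ * c / (1 - δ) + 2 * δ ^ n)))
        (fun S Λ hS hcl hΛ => norm_ratio_sub_le_of_clique hμ hR hsymm hg hg1 hc ih hS hcl hΛ)
        t ht {w | ¬ R z w}ᶜ Λ (measurableSet_not_rel hR z).compl hΛ
        ((Set.subset_univ _).trans htu)
      rw [compl_compl] at h
      refine h.trans ?_
      have h4 : {w | ¬ R z w}ᶜ = {w | R z w} := by ext; simp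
      have h5 : 0 ≤ c + (δ * c / (1 - δ) + 2 * δ ^ n) := by
        have := (norm_nonneg _).trans (ih Λ z hΛ)
        linarith
      rw [h4]
      calc μ * (c + (δ * c / (1 - δ) + 2 * δ ^ n)) * m.real {w | R z w}
          = (μ * m.real {w | R z w}) * (c + (δ * c / (1 - δ) + 2 * δ ^ n)) := by ring
        _ ≤ δ * (c + (δ * c / (1 - δ) + 2 * δ ^ n)) := mul_le_mul_of_nonneg_right (hδ z) h5
        _ = _ := by field_simp; ring
  have hlim : Tendsto (fun n : ℕ => δ * c / (1 - δ) + 2 * δ ^ n) atTop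
      (𝓝 (δ * c / (1 - δ) + 2 * 0)) :=
    ((tendsto_pow_atTop_nhds_zero_of_lt_one hδ0 hδ1).const_mul 2).const_add _
  rw [mul_zero, add_zero] at hlim
  exact ge_of_tendsto' hlim fun n => key n Λ z hΛ

theorem norm_confined_div_sub_one_le (hμ : 0 ≤ μ) (hR : MeasurableSet {q : E × E | R q.1 q.2})
    (hsymm : ∀ x y, R x y → R y x)
    (hcover : ∃ t : Finset (Set E), (∀ S ∈ t, MeasurableSet S ∧ ∀ x ∈ S, ∀ y ∈ S, R x y) ∧
      Set.univ ⊆ ⋃ S ∈ t, S)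
    {δ : ℝ} (hδ : ∀ z, μ * m.real {w | R z w} ≤ δ) (z : E) :
    ‖(confined m R μ {w | ¬ R z w} : ℂ) / confined m R μ Set.univ - 1‖ ≤ δ := by
  obtain ⟨t, ht, htu⟩ := hcover
  have hZ := confined_pos (m := m) (R := R) hμ MeasurableSet.univ
  have hZ0 : (confined m R μ Set.univ : ℂ) ≠ 0 := by exact_mod_cast hZ.ne'
  have h := norm_sub_le_of_cover (m := m) (R := R) (f := fun Λ => (confined m R μ Λ : ℂ))
    (C := μ * confined m R μ Set.univ)
    (fun S Λ hS hcl hΛ => norm_confined_sub_le_of_clique hμ hR hsymm hS hcl hΛ)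
    t ht {w | ¬ R z w}ᶜ Set.univ (measurableSet_not_rel hR z).compl MeasurableSet.univ
    ((Set.subset_univ _).trans htu)
  rw [compl_compl, Set.inter_univ, norm_sub_rev] at h
  have h4 : {w | ¬ R z w}ᶜ = {w | R z w} := by ext; simp
  rw [h4] at h
  rw [div_sub_one hZ0, norm_div, Complex.norm_real, Real.norm_of_nonneg hZ.le, div_le_iff₀ hZ]
  refine h.trans ?_
  nlinarith [hδ z]

theorem norm_sub_exp_le_of_deriv {ψ ψ' : ℝ → ℂ} {s η : ℝ} (h : ∀ t, HasDerivAt ψ (ψ' t) t)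
    (h0 : ψ 0 = 1) (hs : 0 ≤ s) (hη : ∀ t ∈ Set.Icc (0 : ℝ) 1, ‖ψ' t + t * s * ψ t‖ ≤ η) :
    ‖ψ 1 - Complex.exp (-s / 2)‖ ≤ η := by
  have hE : ∀ t : ℝ, HasDerivAt (fun t : ℝ => Complex.exp (s * t ^ 2 / 2))
      (Complex.exp (s * t ^ 2 / 2) * (s * t)) t := by
    intro t
    have h1 : HasDerivAt (fun z : ℂ => Complex.exp (s * z ^ 2 / 2))
        (Complex.exp (s * (t : ℂ) ^ 2 / 2) * (s * t)) (t : ℂ) := by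
      have := (((hasDerivAt_pow 2 (t : ℂ)).const_mul (s : ℂ)).div_const 2).cexp
      convert! this using 2
      push_cast
      ring
    exact h1.comp_ofReal
  have hD : ∀ t : ℝ, HasDerivAt (fun t : ℝ => ψ t * Complex.exp (s * t ^ 2 / 2))
      (ψ' t * Complex.exp (s * t ^ 2 / 2) + ψ t * (Complex.exp (s * t ^ 2 / 2) * (s * t))) t :=
    fun t => (h t).mul (hE t)
  have hη0 : 0 ≤ η := (norm_nonneg _).trans (hη 0 (by simp))
  have := norm_image_sub_le_of_norm_deriv_le_segment_01' (C := η * Real.exp (s / 2))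
    (fun t _ => (hD t).hasDerivWithinAt) (fun t ht => by
      have e : ψ' t * Complex.exp (s * t ^ 2 / 2) + ψ t * (Complex.exp (s * t ^ 2 / 2) * (s * t)) =
        (ψ' t + t * s * ψ t) * Complex.exp ((s * t ^ 2 / 2 : ℝ)) := by
        push_cast
        ring
      rw [e, norm_mul, Complex.norm_exp_ofReal]
      refine mul_le_mul (hη t ⟨ht.1, ht.2.le⟩) ?_ (Real.exp_pos _).le hη0
      refine Real.exp_le_exp.2 ?_
      have : t ^ 2 ≤ 1 := pow_le_one₀ ht.1 ht.2.le
      nlinarith)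
  simp only [h0, Complex.ofReal_one, Complex.ofReal_zero] at this
  have e2 : ψ 1 - Complex.exp (-s / 2) = (ψ 1 * Complex.exp (s * 1 ^ 2 / 2) -
      1 * Complex.exp (s * 0 ^ 2 / 2)) * Complex.exp ((-s / 2 : ℝ)) := by
    have : Complex.exp (s / 2) * Complex.exp (-s / 2) = 1 := by
      rw [← Complex.exp_add]
      ring_nf
      exact Complex.exp_zero
    push_cast
    simp only [one_pow, mul_one, ne_eq, OfNat.ofNat_ne_zero, not_false_eq_true, zero_pow, mul_zero,
      zero_div, Complex.exp_zero]
    linear_combination (-ψ 1) * this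
  rw [e2, norm_mul, Complex.norm_exp_ofReal]
  calc _ ≤ η * Real.exp (s / 2) * Real.exp (-s / 2) :=
        mul_le_mul_of_nonneg_right this (Real.exp_pos _).le
    _ = η := by rw [mul_assoc, ← Real.exp_add]; ring_nf; simp

theorem hasDerivAt_prod_exp {ι : Type*} [Fintype ι] [DecidableEq ι] (x : ι → ℝ) (t : ℝ) :
    HasDerivAt (fun t : ℝ => ∏ i, Complex.exp (t * x i * Complex.I))
      (∑ i, (Complex.exp (t * x i * Complex.I) * (x i * Complex.I)) *
        ∏ j ∈ Finset.univ.erase i, Complex.exp (t * x j * Complex.I)) t := by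
  have h1 : ∀ i ∈ (Finset.univ : Finset ι), HasDerivAt
      (fun t : ℝ => Complex.exp (t * x i * Complex.I))
      (Complex.exp (t * x i * Complex.I) * (x i * Complex.I)) t := by
    intro i _
    have h2 : HasDerivAt (fun z : ℂ => Complex.exp (z * x i * Complex.I))
        (Complex.exp (t * x i * Complex.I) * (x i * Complex.I)) (t : ℂ) := by
      have := (((hasDerivAt_id (t : ℂ)).mul_const (x i : ℂ)).mul_const Complex.I).cexp
      simpa using this
    exact h2.comp_ofReal
  have h3 := HasDerivAt.fun_finsetProd h1
  simp only [smul_eq_mul] at h3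
  simp_rw [mul_comm (∏ j ∈ _, _) _] at h3
  exact h3

theorem integrable_mul_card_add_one (hμ : 0 ≤ μ) {b : ℝ} (hb0 : 0 ≤ b) :
    Integrable (fun ω : (Σ N : ℕ, (Fin N → E)) => b * ((ω.1 : ℝ) + 1)) (hardCore m R μ) := by
  have hm : Measurable fun ω : (Σ N : ℕ, (Fin N → E)) => ((b * ((ω.1 : ℝ) + 1) : ℝ) : ℂ) :=
    measurable_sigma_iff.2 fun a => by
      change Measurable fun _ : Fin a → E => ((b * ((a : ℝ) + 1) : ℝ) : ℂ)
      exact measurable_const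
  exact (integrable_of_le_card (m := m) (R := R) hμ hm b fun ω => by
    rw [Complex.norm_real, Real.norm_of_nonneg (by positivity)]).re

theorem hasDerivAt_genFun (hμ : 0 ≤ μ) (hR : MeasurableSet {q : E × E | R q.1 q.2})
    (hsymm : ∀ x y, R x y → R y x) {φ : E → ℝ} (hφ : Measurable φ) {b : ℝ} (hb : ∀ z, |φ z| ≤ b)
    (hb0 : 0 ≤ b) (t : ℝ) :
    HasDerivAt (fun t : ℝ => genFun m R μ fun z => Complex.exp (t * φ z * Complex.I))
      (μ * ∫ z, (Complex.exp (t * φ z * Complex.I) * (φ z * Complex.I)) *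
        genFun m R μ ({w | ¬ R z w}.indicator fun z => Complex.exp (t * φ z * Complex.I)) ∂m) t := by
  have hgm : ∀ t : ℝ, Measurable fun z => Complex.exp (t * φ z * Complex.I) := fun t => by fun_prop
  have hg1 : ∀ (t : ℝ) z, ‖Complex.exp (t * φ z * Complex.I)‖ ≤ 1 := fun t z => by
    have := Complex.norm_exp_ofReal_mul_I (t * φ z)
    push_cast at this
    exact this.le
  have hub : ∀ (t : ℝ) z, ‖Complex.exp (t * φ z * Complex.I) * (φ z * Complex.I)‖ ≤ b := by
    intro t z
    rw [norm_mul, norm_mul, Complex.norm_I, mul_one, Complex.norm_real]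
    exact (mul_le_of_le_one_left (norm_nonneg _) (hg1 t z)).trans (hb z)
  have hum : ∀ t : ℝ, Measurable fun z => Complex.exp (t * φ z * Complex.I) * (φ z * Complex.I) :=
    fun t => by fun_prop
  rw [← integral_sum_erase hμ hR hsymm (hum t) (hgm t) (hub t) (hg1 t) hb0]
  have hFm : ∀ᶠ t : ℝ in 𝓝 t, AEStronglyMeasurable (fun ω : (Σ N : ℕ, (Fin N → E)) =>
      ∏ i, Complex.exp (t * φ (ω.2 i) * Complex.I)) (hardCore m R μ) :=
    Eventually.of_forall fun t => (measurable_prod_apply (hgm t)).aestronglyMeasurable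
  have hFi := integrable_prod (m := m) (R := R) hμ (hgm t) (hg1 t)
  have hFm' := (measurable_sum_erase (hum t) (hgm t)).aestronglyMeasurable (μ := hardCore m R μ)
  have hFb : ∀ᵐ ω ∂(hardCore m R μ), ∀ t ∈ (Set.univ : Set ℝ),
      ‖∑ i, (Complex.exp (t * φ (ω.2 i) * Complex.I) * (φ (ω.2 i) * Complex.I)) *
        ∏ j ∈ Finset.univ.erase i, Complex.exp (t * φ (ω.2 j) * Complex.I)‖ ≤
        b * ((ω.1 : ℝ) + 1) :=
    ae_of_all _ fun ω t _ => norm_sum_erase_le (hub t) (hg1 t) hb0 ω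
  have hFd : ∀ᵐ ω ∂(hardCore m R μ), ∀ t ∈ (Set.univ : Set ℝ), HasDerivAt
      (fun t : ℝ => ∏ i, Complex.exp (t * φ (ω.2 i) * Complex.I))
      (∑ i, (Complex.exp (t * φ (ω.2 i) * Complex.I) * (φ (ω.2 i) * Complex.I)) *
        ∏ j ∈ Finset.univ.erase i, Complex.exp (t * φ (ω.2 j) * Complex.I)) t :=
    ae_of_all _ fun ω t _ => hasDerivAt_prod_exp (fun i => φ (ω.2 i)) t
  have hbi := integrable_mul_card_add_one (m := m) (R := R) hμ hb0
  have hres := hasDerivAt_integral_of_dominated_loc_of_deriv_le (x₀ := t) (s := Set.univ)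
    (F := fun (t : ℝ) (ω : Σ N : ℕ, (Fin N → E)) => ∏ i, Complex.exp (t * φ (ω.2 i) * Complex.I))
    (F' := fun (t : ℝ) (ω : Σ N : ℕ, (Fin N → E)) => ∑ i,
      (Complex.exp (t * φ (ω.2 i) * Complex.I) * (φ (ω.2 i) * Complex.I)) *
        ∏ j ∈ Finset.univ.erase i, Complex.exp (t * φ (ω.2 j) * Complex.I))
    Filter.univ_mem hFm hFi hFm' hFb hbi hFd
  exact hres.2

theorem integral_sum_hardCore (hμ : 0 ≤ μ) (hR : MeasurableSet {q : E × E | R q.1 q.2})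
    (hsymm : ∀ x y, R x y → R y x) {φ : E → ℝ} (hφ : Measurable φ) {b : ℝ} (hb : ∀ z, |φ z| ≤ b)
    (hb0 : 0 ≤ b) :
    ((∫ ω, ∑ i, φ (ω.2 i) ∂(hardCore m R μ) : ℝ) : ℂ) =
      μ * ∫ z, φ z * (confined m R μ {w | ¬ R z w} : ℂ) ∂m := by
  have h := integral_sum_erase (m := m) (R := R) hμ hR hsymm (u := fun z => (φ z : ℂ)) (v := 1)
    (by fun_prop) measurable_one (fun z => by rw [Complex.norm_real]; exact hb z) (by simp) hb0
  simp_rw [genFun_indicator_one (measurableSet_not_rel hR _)] at h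
  rw [← h, ← integral_complex_ofReal]
  refine integral_congr_ae (ae_of_all _ fun ω => ?_)
  simp

/-- Quantitative comparison of the characteristic function of a centred linear statistic with
a Gaussian one. -/
theorem norm_charFun_sub_le (hμ : 0 ≤ μ) (hR : MeasurableSet {q : E × E | R q.1 q.2})
    (hsymm : ∀ x y, R x y → R y x)
    (hcover : ∃ t : Finset (Set E), (∀ S ∈ t, MeasurableSet S ∧ ∀ x ∈ S, ∀ y ∈ S, R x y) ∧
      Set.univ ⊆ ⋃ S ∈ t, S)
    {δ : ℝ} (hδ0 : 0 ≤ δ) (hδ1 : δ < 1) (hδ : ∀ z, μ * m.real {w | R z w} ≤ δ)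
    {φ : E → ℝ} (hφ : Measurable φ) {b : ℝ} (hb : ∀ z, |φ z| ≤ b) (hb0 : 0 ≤ b) (hb1 : b ≤ 1) :
    ‖genFun m R μ (fun z => Complex.exp (φ z * Complex.I)) / confined m R μ Set.univ *
        Complex.exp (-(((∫ ω, ∑ i, φ (ω.2 i) ∂(hardCore m R μ)) / confined m R μ Set.univ : ℝ) *
          Complex.I)) - Complex.exp (-(μ * ∫ z, φ z ^ 2 ∂m : ℝ) / 2)‖ ≤
      μ * (b ^ 2 * δ / (1 - δ) + b ^ 3 + b ^ 2 * δ) := by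
  have hZ := confined_pos (m := m) (R := R) hμ MeasurableSet.univ
  set Z := confined m R μ Set.univ with hZdef
  have hZ0 : (Z : ℂ) ≠ 0 := by exact_mod_cast hZ.ne'
  set κ : ℝ := (∫ ω, ∑ i, φ (ω.2 i) ∂(hardCore m R μ)) / Z with hκ
  have hκ' : (κ : ℂ) = μ * (∫ z, φ z * (confined m R μ {w | ¬ R z w} : ℂ) ∂m) / Z := by
    rw [hκ, Complex.ofReal_div, integral_sum_hardCore hμ hR hsymm hφ hb hb0]
  set g : ℝ → E → ℂ := fun t z => Complex.exp (t * φ z * Complex.I) with hg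
  have hgm : ∀ t : ℝ, Measurable (g t) := fun t => by fun_prop
  have hg1 : ∀ (t : ℝ) z, ‖g t z‖ ≤ 1 := fun t z => by
    have := Complex.norm_exp_ofReal_mul_I (t * φ z)
    push_cast at this
    exact this.le
  have hone : ∀ z, ‖(1 : E → ℂ) z‖ ≤ 1 := by simp
  have hub : ∀ (t : ℝ) z, ‖g t z * (φ z * Complex.I)‖ ≤ b := by
    intro t z
    rw [norm_mul, norm_mul, Complex.norm_I, mul_one, Complex.norm_real]
    exact (mul_le_of_le_one_left (norm_nonneg _) (hg1 t z)).trans (hb z)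
  have hφb : ∀ z, ‖(φ z : ℂ)‖ ≤ b := fun z => by rw [Complex.norm_real]; exact hb z
  set D : ℝ → ℂ := fun t => μ * ∫ z, (g t z * (φ z * Complex.I)) *
    genFun m R μ ({w | ¬ R z w}.indicator (g t)) ∂m with hD
  have hderiv : ∀ t : ℝ, HasDerivAt (fun t : ℝ => genFun m R μ (g t) / Z *
      Complex.exp (-(t * κ * Complex.I)))
      (D t / Z * Complex.exp (-(t * κ * Complex.I)) + genFun m R μ (g t) / Z *
        (Complex.exp (-(t * κ * Complex.I)) * (-(κ * Complex.I)))) t := by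
    intro t
    have h1 : HasDerivAt (fun t : ℝ => genFun m R μ (g t)) (D t) t :=
      hasDerivAt_genFun hμ hR hsymm hφ hb hb0 t
    have h2 : HasDerivAt (fun z : ℂ => Complex.exp (-(z * κ * Complex.I)))
        (Complex.exp (-(t * κ * Complex.I)) * (-(κ * Complex.I))) (t : ℂ) := by
      have := (((hasDerivAt_id (t : ℂ)).mul_const (κ : ℂ)).mul_const Complex.I).neg.cexp
      simpa using this
    exact (h1.div_const _).mul h2.comp_ofReal
  have hs : 0 ≤ μ * ∫ z, φ z ^ 2 ∂m := mul_nonneg hμ (integral_nonneg fun z => sq_nonneg _)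
  have h00 : genFun m R μ (g 0) / Z * Complex.exp (-((0 : ℝ) * κ * Complex.I)) = 1 := by
    have : g 0 = Set.univ.indicator 1 := by
      ext z
      simp [hg]
    rw [this, genFun_indicator_one MeasurableSet.univ, ← hZdef, div_self hZ0]
    simp
  have main := norm_sub_exp_le_of_deriv hderiv h00 hs
    (η := μ * (b ^ 2 * δ / (1 - δ) + b ^ 3 + b ^ 2 * δ)) (fun t ht => by
      set χ := genFun m R μ (g t) / Z with hχ
      have hχr : χ = ratio m R μ (g t) Set.univ := by rw [ratio, Set.indicator_univ]
      have hχ1 : ‖χ‖ ≤ 1 := hχr ▸ norm_ratio_le_one hμ (hg1 t) MeasurableSet.univ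
      have i1 := integrable_indicator_mul_genFun (m := m) (R := R) hμ hR (hgm t) (hg1 t)
        (u := fun z => g t z * (φ z * Complex.I))
        (by fun_prop) (hub t) MeasurableSet.univ
      have i2 := integrable_indicator_mul_genFun (m := m) (R := R) hμ hR measurable_one hone
        (u := fun z => (φ z : ℂ)) (by fun_prop) hφb MeasurableSet.univ
      simp only [Set.inter_univ] at i1 i2
      simp_rw [genFun_indicator_one (measurableSet_not_rel hR _)] at i2
      have i3 : Integrable (fun z => ((φ z ^ 2 : ℝ) : ℂ)) m := by
        refine Integrable.of_bound (C := b ^ 2) (Measurable.aestronglyMeasurable (by fun_prop))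
          (ae_of_all _ fun z => ?_)
        rw [Complex.norm_real, Real.norm_of_nonneg (sq_nonneg _), ← sq_abs]
        exact pow_le_pow_left₀ (abs_nonneg _) (hb z) 2
      have e1 : D t / Z * Complex.exp (-(t * κ * Complex.I)) + χ *
          (Complex.exp (-(t * κ * Complex.I)) * (-(κ * Complex.I))) +
          t * (μ * ∫ z, φ z ^ 2 ∂m : ℝ) * (χ * Complex.exp (-(t * κ * Complex.I))) =
          (μ * ∫ z, ((g t z * (φ z * Complex.I) *
              genFun m R μ ({w | ¬ R z w}.indicator (g t)) * (Z : ℂ)⁻¹ -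
            φ z * (confined m R μ {w | ¬ R z w} : ℂ) * (χ * Complex.I * (Z : ℂ)⁻¹)) +
            ((φ z ^ 2 : ℝ) : ℂ) * (t * χ)) ∂m) * Complex.exp (-(t * κ * Complex.I)) := by
        have i12 : Integrable (fun z => g t z * (φ z * Complex.I) *
              genFun m R μ ({w | ¬ R z w}.indicator (g t)) * (Z : ℂ)⁻¹ -
            φ z * (confined m R μ {w | ¬ R z w} : ℂ) * (χ * Complex.I * (Z : ℂ)⁻¹)) m :=
          (i1.mul_const _).sub (i2.mul_const _)
        rw [integral_add i12 (i3.mul_const _),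
          integral_sub (i1.mul_const _) (i2.mul_const _), integral_mul_const, integral_mul_const,
          integral_mul_const, integral_complex_ofReal, hκ', Complex.ofReal_mul]
        simp only [hD]
        generalize (∫ z, g t z * (φ z * Complex.I) *
          genFun m R μ ({w | ¬ R z w}.indicator (g t)) ∂m) = J
        field_simp
        ring
      have e2 : ‖Complex.exp (-(t * κ * Complex.I))‖ = 1 := by
        have := Complex.norm_exp_ofReal_mul_I (-(t * κ))
        push_cast at this
        rw [neg_mul] at this
        exact this
      rw [e1, norm_mul, e2, mul_one, norm_mul, Complex.norm_real, Real.norm_of_nonneg hμ]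
      refine mul_le_mul_of_nonneg_left ?_ hμ
      have hc : ∀ z, ‖g t z - 1‖ ≤ b := by
        intro z
        have h1 := Real.norm_exp_I_mul_ofReal_sub_one_le (x := t * φ z)
        have h2 : g t z = Complex.exp (Complex.I * (t * φ z : ℝ)) := by
          simp only [hg]
          push_cast
          ring_nf
        rw [h2]
        refine h1.trans ?_
        rw [Real.norm_eq_abs, abs_mul, abs_of_nonneg ht.1]
        nlinarith [hb z, ht.1, ht.2, abs_nonneg (φ z)]
      refine (norm_integral_le_of_norm_le (integrable_const
        (b ^ 2 * δ / (1 - δ) + b ^ 3 + b ^ 2 * δ)) (ae_of_all _ fun z => ?_)).trans (by simp)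
      have hA := measurableSet_not_rel hR z
      have hdec := norm_ratio_sub_avoid_le hμ hR hsymm hcover hδ1 hδ (hgm t) (hg1 t) hc
        MeasurableSet.univ z
      rw [Set.inter_univ, ← hχr] at hdec
      have hP := norm_confined_div_sub_one_le hμ hR hsymm hcover hδ z
      rw [← hZdef] at hP
      rw [← ratio_mul_confined hμ (g t) hA]
      set e := ratio m R μ (g t) {w | ¬ R z w} with he
      set P : ℂ := (confined m R μ {w | ¬ R z w} : ℂ) / Z with hPdef
      have hP1 : ‖P‖ ≤ 1 := by
        rw [hPdef, norm_div, Complex.norm_real, Complex.norm_real, Real.norm_of_nonneg hZ.le,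
          Real.norm_of_nonneg (confined_pos hμ hA).le, div_le_one hZ]
        exact confined_mono hμ (Set.subset_univ _)
      have e3 : g t z * (φ z * Complex.I) * (e * confined m R μ {w | ¬ R z w}) * (Z : ℂ)⁻¹ -
            φ z * (confined m R μ {w | ¬ R z w} : ℂ) * (χ * Complex.I * (Z : ℂ)⁻¹) +
            ((φ z ^ 2 : ℝ) : ℂ) * (t * χ) =
          -(φ z * Complex.I * P * g t z * (χ - e)) +
            φ z * Complex.I * P * χ * (g t z - 1 - t * φ z * Complex.I) -
            t * φ z ^ 2 * (P - 1) * χ := by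
        rw [hPdef]
        push_cast
        field_simp
        linear_combination ((φ z : ℂ) ^ 2 * t * χ * confined m R μ {w | ¬ R z w}) * Complex.I_sq
      rw [e3]
      have ht1 : ‖(t : ℂ)‖ ≤ 1 := by
        rw [Complex.norm_real, Real.norm_of_nonneg ht.1]; exact ht.2
      have hx : ‖(t : ℂ) * φ z * Complex.I‖ ≤ b := by
        rw [norm_mul, norm_mul, Complex.norm_I, mul_one]
        exact (mul_le_of_le_one_left (norm_nonneg _) ht1).trans (hφb z)
      have n1 : ‖φ z * Complex.I * P * g t z * (χ - e)‖ ≤ b ^ 2 * δ / (1 - δ) := by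
        rw [norm_mul, norm_mul, norm_mul, norm_mul, Complex.norm_I, mul_one]
        calc _ ≤ b * 1 * 1 * (δ * b / (1 - δ)) := by
              gcongr
              exacts [hφb z, hg1 t z]
          _ = _ := by ring
      have n2 : ‖φ z * Complex.I * P * χ * (g t z - 1 - t * φ z * Complex.I)‖ ≤ b ^ 3 := by
        have h3 : ‖g t z - 1 - t * φ z * Complex.I‖ ≤ b ^ 2 :=
          (Complex.norm_exp_sub_one_sub_id_le (hx.trans hb1)).trans
            (pow_le_pow_left₀ (norm_nonneg _) hx 2)
        rw [norm_mul, norm_mul, norm_mul, norm_mul, Complex.norm_I, mul_one]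
        calc _ ≤ b * 1 * 1 * b ^ 2 := by
              gcongr
              exact hφb z
          _ = _ := by ring
      have n3 : ‖t * φ z ^ 2 * (P - 1) * χ‖ ≤ b ^ 2 * δ := by
        rw [norm_mul, norm_mul, norm_mul, norm_pow]
        calc _ ≤ 1 * b ^ 2 * δ * 1 := by
              gcongr
              exact hφb z
          _ = _ := by ring
      refine (norm_sub_le _ _).trans (add_le_add ((norm_add_le _ _).trans (add_le_add ?_ n2)) n3)
      rwa [norm_neg])
  have hg1' : g 1 = fun z => Complex.exp (φ z * Complex.I) := by
    ext z
    simp [hg]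
  rw [hg1'] at main
  simpa using main

end HardCore

noncomputable section HardSpheres

theorem lintegral_prod_ofReal {E : Type*} [MeasurableSpace E] {N : ℕ} (ν : Fin N → Measure E)
    [∀ i, SigmaFinite (ν i)] {f : E → ℝ} (hf0 : ∀ z, 0 ≤ f z) (hf : ∀ i, Integrable f (ν i)) :
    ∫⁻ Z, ∏ i, ENNReal.ofReal (f (Z i)) ∂(Measure.pi ν) =
      ∏ i, ∫⁻ z, ENNReal.ofReal (f z) ∂(ν i) := by
  have h1 := ofReal_integral_eq_lintegral_ofReal
    (Integrable.fintype_prod (f := fun _ => f) (μ := ν) hf)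
    (ae_of_all _ fun Z => Finset.prod_nonneg fun i _ => hf0 (Z i))
  simp_rw [ENNReal.ofReal_prod_of_nonneg fun i _ => hf0 _] at h1
  rw [← h1, integral_fintype_prod_eq_prod (𝕜 := ℝ) (fun _ => f),
    ENNReal.ofReal_prod_of_nonneg fun i _ => integral_nonneg hf0]
  exact Finset.prod_congr rfl fun i _ =>
    ofReal_integral_eq_lintegral_ofReal (hf i) (ae_of_all _ hf0)

theorem pi_withDensity_ofReal {E : Type*} [MeasurableSpace E] {N : ℕ} (ν : Measure E)
    [SigmaFinite ν] {f : E → ℝ} (hf0 : ∀ z, 0 ≤ f z) (hf : Integrable f ν) :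
    (Measure.pi fun _ : Fin N => ν.withDensity fun z => ENNReal.ofReal (f z)) =
      (Measure.pi fun _ => ν).withDensity fun Z => ∏ i, ENNReal.ofReal (f (Z i)) := by
  have := isFiniteMeasure_withDensity_ofReal hf.2
  refine Measure.pi_eq fun s hs => ?_
  rw [withDensity_apply _ (MeasurableSet.univ_pi hs), Measure.restrict_pi_pi,
    lintegral_prod_ofReal _ hf0 fun i => hf.restrict]
  exact Finset.prod_congr rfl fun i _ => (withDensity_apply _ (hs i)).symm

instance : IsProbabilityMeasure (volume : Measure UnitAddCircle) :=
  ⟨UnitAddCircle.measure_univ⟩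

instance (d : ℕ) : IsProbabilityMeasure (volume : Measure (Torus d)) :=
  inferInstanceAs (IsProbabilityMeasure (Measure.pi fun _ : Fin d => (volume : Measure UnitAddCircle)))

instance (d N : ℕ) : IsProbabilityMeasure (volume : Measure (Fin N → Torus d)) :=
  inferInstanceAs (IsProbabilityMeasure (Measure.pi fun _ : Fin N => (volume : Measure (Torus d))))

theorem Maxw_nonneg (d : ℕ) (v : Rd d) : 0 ≤ Maxw d v := by
  unfold Maxw
  positivity

theorem continuous_Maxw (d : ℕ) : Continuous (Maxw d) := by
  unfold Maxw
  fun_prop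

theorem integral_Maxw (d : ℕ) : ∫ v, Maxw d v = 1 := by
  have h := GaussianFourier.integral_rexp_neg_mul_sq_norm (V := Rd d) (b := 1 / 2) (by norm_num)
  have h2 : ∀ v : Rd d, Real.exp (-‖v‖ ^ 2 / 2) = Real.exp (-(1 / 2) * ‖v‖ ^ 2) := fun v => by
    ring_nf
  simp_rw [Maxw, integral_const_mul, h2]
  rw [h, finrank_euclideanSpace, Fintype.card_fin, div_div_eq_mul_div, div_one, mul_comm π 2,
    ← Real.rpow_add (by positivity), neg_div, neg_add_cancel, Real.rpow_zero]

theorem integrable_Maxw (d : ℕ) : Integrable (Maxw d) :=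
  Integrable.of_integral_ne_zero (by rw [integral_Maxw]; exact one_ne_zero)

theorem integrable_Maxw_snd (d : ℕ) : Integrable fun z : Torus d × Rd d => Maxw d z.2 :=
  (integrable_Maxw d).comp_snd _

/-- The equilibrium law of a single particle. -/
def oneParticle (d : ℕ) : Measure (Torus d × Rd d) :=
  volume.withDensity fun z => ENNReal.ofReal (Maxw d z.2)

theorem oneParticle_eq_prod (d : ℕ) : oneParticle d =
    (volume : Measure (Torus d)).prod (volume.withDensity fun v => ENNReal.ofReal (Maxw d v)) :=
  (prod_withDensity_right (continuous_Maxw d).measurable.ennreal_ofReal).symm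

instance (d : ℕ) : IsProbabilityMeasure
    ((volume : Measure (Rd d)).withDensity fun v => ENNReal.ofReal (Maxw d v)) := by
  refine ⟨?_⟩
  rw [withDensity_apply _ MeasurableSet.univ, Measure.restrict_univ, ← ofReal_integral_eq_lintegral_ofReal (integrable_Maxw d) (ae_of_all _ (Maxw_nonneg d)),
    integral_Maxw, ENNReal.ofReal_one]

instance (d : ℕ) : IsProbabilityMeasure (oneParticle d) := by
  rw [oneParticle_eq_prod]
  infer_instance

theorem measurePreserving_fst_oneParticle (d : ℕ) :
    MeasurePreserving Prod.fst (oneParticle d) (volume : Measure (Torus d)) := by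
  rw [oneParticle_eq_prod]
  exact measurePreserving_fst

theorem integral_oneParticle (d : ℕ) (f : Torus d × Rd d → ℝ) :
    ∫ z, f z ∂(oneParticle d) = ∫ z, f z * Maxw d z.2 := by
  have hm : Measurable fun z : Torus d × Rd d => ENNReal.ofReal (Maxw d z.2) :=
    ((continuous_Maxw d).measurable.comp measurable_snd).ennreal_ofReal
  rw [oneParticle, integral_withDensity_eq_integral_toReal_smul hm (by simp)]
  refine integral_congr_ae (ae_of_all _ fun z => ?_)
  simp only [smul_eq_mul, ENNReal.toReal_ofReal (Maxw_nonneg d z.2)]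
  ring

/-- Two particles overlap when their positions are within distance `ε`. -/
def overlap (d : ℕ) (ε : ℝ) (z w : Torus d × Rd d) : Prop := dist z.1 w.1 ≤ ε

theorem measurableSet_overlap (d : ℕ) (ε : ℝ) :
    MeasurableSet {q : (Torus d × Rd d) × (Torus d × Rd d) | overlap d ε q.1 q.2} :=
  measurableSet_le (by fun_prop) measurable_const

theorem overlap_symm (d : ℕ) (ε : ℝ) (z w : Torus d × Rd d) (h : overlap d ε z w) :
    overlap d ε w z := by
  rwa [overlap, dist_comm]

theorem exists_cover_overlap (d : ℕ) {ε : ℝ} (hε : 0 < ε) :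
    ∃ t : Finset (Set (Torus d × Rd d)),
      (∀ S ∈ t, MeasurableSet S ∧ ∀ x ∈ S, ∀ y ∈ S, overlap d ε x y) ∧
      Set.univ ⊆ ⋃ S ∈ t, S := by
  obtain ⟨s, -, hs⟩ := (isCompact_univ (X := Torus d)).finite_cover_balls (half_pos hε)
  refine ⟨hs.1.toFinset.image fun c => Prod.fst ⁻¹' Metric.ball c (ε / 2), ?_, ?_⟩
  · intro S hS
    obtain ⟨c, -, rfl⟩ := Finset.mem_image.1 hS
    refine ⟨measurable_fst measurableSet_ball, fun x hx y hy => ?_⟩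
    have h1 : dist x.1 c < ε / 2 := hx
    have h2 : dist y.1 c < ε / 2 := hy
    have h3 := dist_triangle_right x.1 y.1 c
    exact (by linarith : dist x.1 y.1 ≤ ε)
  · intro z _
    obtain ⟨c, hc, hz⟩ := Set.mem_iUnion₂.1 (hs.2 (Set.mem_univ z.1))
    refine Set.mem_iUnion₂.2 ⟨_, Finset.mem_image_of_mem _ (hs.1.mem_toFinset.2 hc), hz⟩

theorem oneParticle_real_overlap_le (d : ℕ) {ε : ℝ} (hε : 0 ≤ ε) (z : Torus d × Rd d) :
    (oneParticle d).real {w | overlap d ε z w} ≤ (2 * ε) ^ d := by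
  have h1 : {w | overlap d ε z w} = Prod.fst ⁻¹' Metric.closedBall z.1 ε := by
    ext w
    simp [overlap, dist_comm]
  rw [Measure.real, h1, (measurePreserving_fst_oneParticle d).measure_preimage
    Metric.isClosed_closedBall.measurableSet.nullMeasurableSet, closedBall_pi _ hε, volume_pi_pi]
  simp_rw [AddCircle.volume_closedBall]
  rw [Finset.prod_const, Finset.card_univ, Fintype.card_fin, ENNReal.toReal_pow,
    ENNReal.toReal_ofReal (by positivity)]
  exact pow_le_pow_left₀ (by positivity) (min_le_right _ _) d

theorem pairAvoiding_overlap (d : ℕ) (ε : ℝ) (N : ℕ) :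
    pairAvoiding (overlap d ε) N = (fun Z i => (Z i).1) ⁻¹' excl d ε N := by
  ext Z
  simp [pairAvoiding, overlap, excl]

theorem pi_oneParticle_pairAvoiding (d : ℕ) (ε : ℝ) (N : ℕ) :
    (Measure.pi fun _ => oneParticle d) (pairAvoiding (overlap d ε) N) =
      ENNReal.ofReal (exclInt d ε N) := by
  have hm : MeasurableSet (excl d ε N) := by
    simp only [excl, Set.ofPred_forall]
    refine MeasurableSet.iInter fun i => MeasurableSet.iInter fun j =>
      MeasurableSet.iInter fun _ => measurableSet_lt measurable_const ?_
    fun_prop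
  rw [pairAvoiding_overlap, (measurePreserving_pi _ _ fun _ : Fin N =>
    measurePreserving_fst_oneParticle d).measure_preimage hm.nullMeasurableSet, exclInt,
    ENNReal.ofReal_toReal (measure_ne_top _ _)]
  rfl

theorem hardCore_overlap_univ (d : ℕ) (ε : ℝ) {μ : ℝ} (hμ : 0 ≤ μ) :
    hardCore (oneParticle d) (overlap d ε) μ Set.univ = ENNReal.ofReal (partFun d ε μ) := by
  have h := lintegral_hardCore (m := oneParticle d) (R := overlap d ε) (μ := μ)
    (f := fun _ => 1) measurable_const
  simp only [lintegral_const, one_mul, Measure.restrict_apply_univ,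
    pi_oneParticle_pairAvoiding] at h
  have hnn : ∀ N, 0 ≤ exclInt d ε N := fun N => ENNReal.toReal_nonneg
  rw [h, partFun, ENNReal.ofReal_tsum_of_nonneg fun N => mul_nonneg (by positivity) (hnn N)]
  · exact tsum_congr fun N => (ENNReal.ofReal_mul (by positivity)).symm
  · refine Summable.of_nonneg_of_le (fun N => mul_nonneg (by positivity) (hnn N)) (fun N => ?_)
      (Real.summable_pow_div_factorial μ)
    refine mul_le_of_le_one_right (by positivity) ?_
    exact ENNReal.toReal_le_of_le_ofReal zero_le_one (by simpa using prob_le_one)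

theorem confined_univ_eq_partFun (d : ℕ) (ε : ℝ) {μ : ℝ} (hμ : 0 ≤ μ) :
    confined (oneParticle d) (overlap d ε) μ Set.univ = partFun d ε μ := by
  have h0 : 0 ≤ partFun d ε μ := tsum_nonneg fun N =>
    mul_nonneg (by positivity) ENNReal.toReal_nonneg
  have : {ω : Σ N : ℕ, (Fin N → Torus d × Rd d) | ∀ i, ω.2 i ∈ Set.univ} = Set.univ := by
    ext
    simp
  rw [confined, this, Measure.real, hardCore_overlap_univ d ε hμ, ENNReal.toReal_ofReal h0]

theorem restrict_pi_oneParticle (d : ℕ) (ε : ℝ) (N : ℕ) :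
    (Measure.pi fun _ => oneParticle d).restrict (pairAvoiding (overlap d ε) N) =
      (volume : Measure (Fin N → Torus d × Rd d)).withDensity
        ((pairAvoiding (overlap d ε) N).indicator fun Z => ∏ i, ENNReal.ofReal (Maxw d (Z i).2)) := by
  have hPA := measurableSet_pairAvoiding (measurableSet_overlap d ε) N
  rw [withDensity_indicator hPA, ← restrict_withDensity hPA]
  exact congrArg (fun ν => Measure.restrict ν _)
    (pi_withDensity_ofReal volume (fun z => Maxw_nonneg d z.2) (integrable_Maxw_snd d))

theorem ofReal_sectorDens (d : ℕ) (ε : ℝ) {μ : ℝ} (hμ : 0 ≤ μ) (N : ℕ)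
    (Z : Fin N → Torus d × Rd d) :
    ENNReal.ofReal (sectorDens d ε μ N Z) = ENNReal.ofReal (μ ^ N / N.factorial) *
      (pairAvoiding (overlap d ε) N).indicator (fun Z => ∏ i, ENNReal.ofReal (Maxw d (Z i).2)) Z := by
  rw [sectorDens, mul_assoc, ENNReal.ofReal_mul (by positivity)]
  congr 1
  by_cases hZ : (fun i => (Z i).1) ∈ excl d ε N
  · have hZ' : Z ∈ pairAvoiding (overlap d ε) N := by rwa [pairAvoiding_overlap]
    rw [if_pos hZ, one_mul, Set.indicator_of_mem hZ',
      ENNReal.ofReal_prod_of_nonneg fun i _ => Maxw_nonneg d _]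
  · have hZ' : Z ∉ pairAvoiding (overlap d ε) N := by rwa [pairAvoiding_overlap]
    rw [if_neg hZ, zero_mul, Set.indicator_of_notMem hZ', ENNReal.ofReal_zero]

theorem gcMeasure_eq_hardCore (d : ℕ) (ε : ℝ) {μ : ℝ} (hμ : 0 ≤ μ) :
    gcMeasure d ε μ = (ENNReal.ofReal (partFun d ε μ))⁻¹ •
      hardCore (oneParticle d) (overlap d ε) μ := by
  rw [gcMeasure, hardCore]
  congr 2
  ext1 N
  have hPA := measurableSet_pairAvoiding (measurableSet_overlap d ε) N
  have hMm : Measurable fun Z : Fin N → Torus d × Rd d =>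
      ∏ i, ENNReal.ofReal (Maxw d (Z i).2) := by
    have := (continuous_Maxw d).measurable
    fun_prop
  rw [restrict_pi_oneParticle, ← Measure.map_smul, ← withDensity_smul _ (hMm.indicator hPA)]
  simp_rw [ofReal_sectorDens d ε hμ N]
  rfl

theorem partFun_pos (d : ℕ) (ε : ℝ) {μ : ℝ} (hμ : 0 ≤ μ) : 0 < partFun d ε μ := by
  rw [← confined_univ_eq_partFun d ε hμ]
  exact confined_pos hμ MeasurableSet.univ

theorem isProbabilityMeasure_gcMeasure (d : ℕ) (ε : ℝ) {μ : ℝ} (hμ : 0 ≤ μ) :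
    IsProbabilityMeasure (gcMeasure d ε μ) := by
  refine ⟨?_⟩
  rw [gcMeasure_eq_hardCore d ε hμ, Measure.smul_apply, hardCore_overlap_univ d ε hμ, smul_eq_mul,
    ENNReal.inv_mul_cancel (by simpa using partFun_pos d ε hμ) ENNReal.ofReal_ne_top]

theorem integral_gcMeasure {F : Type*} [NormedAddCommGroup F] [NormedSpace ℝ F] (d : ℕ) (ε : ℝ)
    {μ : ℝ} (hμ : 0 ≤ μ) (f : Phase d → F) :
    ∫ ω, f ω ∂(gcMeasure d ε μ) =
      (partFun d ε μ)⁻¹ • ∫ ω, f ω ∂(hardCore (oneParticle d) (overlap d ε) μ) := by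
  rw [gcMeasure_eq_hardCore d ε hμ, integral_smul_measure, ENNReal.toReal_inv,
    ENNReal.toReal_ofReal (partFun_pos d ε hμ).le]

theorem measurable_empir {d : ℕ} (μ : ℝ) {h : Torus d × Rd d → ℝ} (hh : Measurable h) :
    Measurable (empir d μ h) :=
  measurable_sigma_iff.2 fun N => by
    change Measurable fun Z : Fin N → Torus d × Rd d => μ⁻¹ * ∑ i, h (Z i)
    fun_prop

theorem measurable_fluct {d : ℕ} (ε μ : ℝ) {h : Torus d × Rd d → ℝ} (hh : Measurable h) :
    Measurable (fluct d ε μ h) :=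
  ((measurable_empir μ hh).sub_const _).const_mul _

theorem integrable_empir {d : ℕ} (ε : ℝ) {μ : ℝ} (hμ : 0 ≤ μ) {h : Torus d × Rd d → ℝ}
    (hh : Measurable h) {B : ℝ} (hB : ∀ z, |h z| ≤ B) :
    Integrable (empir d μ h) (gcMeasure d ε μ) := by
  rw [gcMeasure_eq_hardCore d ε hμ]
  refine Integrable.smul_measure ?_ (by simpa using partFun_pos d ε hμ)
  have hm : Measurable fun ω => ((empir d μ h ω : ℝ) : ℂ) :=
    Complex.measurable_ofReal.comp (measurable_empir μ hh)
  have hB0 : 0 ≤ B := (abs_nonneg _).trans (hB (0, 0))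
  refine (integrable_of_le_card (m := oneParticle d) (R := overlap d ε) hμ hm (μ⁻¹ * B)
    fun ω => ?_).re
  rw [Complex.norm_real, empir, norm_mul, Real.norm_of_nonneg (inv_nonneg.2 hμ), mul_assoc]
  refine mul_le_mul_of_nonneg_left ?_ (inv_nonneg.2 hμ)
  refine (norm_sum_le_of_le _ fun i _ => hB (ω.2 i)).trans ?_
  rw [Finset.sum_const, Finset.card_univ, Fintype.card_fin, nsmul_eq_mul]
  nlinarith

theorem fluct_sum {d p : ℕ} (ε : ℝ) {μ : ℝ} (hμ : 0 ≤ μ) {h : Fin p → (Torus d × Rd d → ℝ)}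
    (hh : ∀ i, Measurable (h i)) (hB : ∀ i, ∃ B : ℝ, ∀ z, |h i z| ≤ B) (a : Fin p → ℝ)
    (ω : Phase d) :
    ∑ i, a i * fluct d ε μ (h i) ω = fluct d ε μ (fun z => ∑ i, a i * h i z) ω := by
  have h1 : ∀ ω, empir d μ (fun z => ∑ i, a i * h i z) ω = ∑ i, a i * empir d μ (h i) ω := by
    intro ω
    simp only [empir]
    rw [Finset.sum_comm, Finset.mul_sum]
    refine Finset.sum_congr rfl fun i _ => ?_
    rw [← Finset.mul_sum]
    ring
  have h2 : ∫ ω, empir d μ (fun z => ∑ i, a i * h i z) ω ∂(gcMeasure d ε μ) =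
      ∑ i, a i * ∫ ω, empir d μ (h i) ω ∂(gcMeasure d ε μ) := by
    simp_rw [h1]
    rw [integral_finsetSum]
    · simp_rw [integral_const_mul]
    · intro i _
      obtain ⟨B, hB⟩ := hB i
      exact (integrable_empir ε hμ (hh i) hB).const_mul _
  simp only [fluct]
  rw [h2, h1, ← Finset.sum_sub_distrib, Finset.mul_sum]
  refine Finset.sum_congr rfl fun i _ => ?_
  ring

/-- Quantitative Gaussian approximation of the characteristic function of a fluctuation. -/
theorem norm_charFun_fluct_sub_le {d : ℕ} {ε μ : ℝ} (hε : 0 < ε) (hμ : 0 < μ)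
    {H : Torus d × Rd d → ℝ} (hH : Measurable H) {B : ℝ} (hB : ∀ z, |H z| ≤ B)
    (hBμ : B ≤ √μ) (hδ : μ * (2 * ε) ^ d < 1) :
    ‖∫ ω, Complex.exp (fluct d ε μ H ω * Complex.I) ∂(gcMeasure d ε μ) -
        Complex.exp (-(∫ z, H z ^ 2 * Maxw d z.2 : ℝ) / 2)‖ ≤
      B ^ 2 * (μ * (2 * ε) ^ d) / (1 - μ * (2 * ε) ^ d) + B ^ 3 / √μ +
        B ^ 2 * (μ * (2 * ε) ^ d) := by
  have hs : 0 < √μ := Real.sqrt_pos.2 hμ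
  have hss : √μ ^ 2 = μ := Real.sq_sqrt hμ.le
  have hB0 : 0 ≤ B := (abs_nonneg _).trans (hB (0, 0))
  have hφ : Measurable fun z => H z / √μ := by fun_prop
  have main := norm_charFun_sub_le (m := oneParticle d) hμ.le (measurableSet_overlap d ε)
    (overlap_symm d ε) (exists_cover_overlap d hε) (δ := μ * (2 * ε) ^ d) (by positivity) hδ
    (fun z => mul_le_mul_of_nonneg_left (oneParticle_real_overlap_le d hε.le z) hμ.le) hφ
    (b := B / √μ) (fun z => by
      rw [abs_div, abs_of_pos hs]
      exact div_le_div_of_nonneg_right (hB z) hs.le) (by positivity) ((div_le_one hs).2 hBμ)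
  rw [confined_univ_eq_partFun d ε hμ.le] at main
  set κ : ℝ := (∫ ω, ∑ i, H (ω.2 i) / √μ ∂(hardCore (oneParticle d) (overlap d ε) μ)) /
    partFun d ε μ with hκ
  have hemp : ∀ ω, √μ * empir d μ H ω = ∑ i, H (ω.2 i) / √μ := by
    intro ω
    have : √μ * μ⁻¹ = (√μ)⁻¹ := by
      nth_rewrite 2 [← hss]
      field_simp
    rw [empir, ← mul_assoc, this, ← Finset.sum_div, div_eq_inv_mul]
  have hfl : ∀ ω, fluct d ε μ H ω = ∑ i, H (ω.2 i) / √μ - κ := by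
    intro ω
    rw [fluct, mul_sub, hemp, ← integral_const_mul]
    simp_rw [hemp]
    rw [integral_gcMeasure d ε hμ.le, hκ, smul_eq_mul, div_eq_inv_mul]
  have e1 : ∫ ω, Complex.exp (fluct d ε μ H ω * Complex.I) ∂(gcMeasure d ε μ) =
      genFun (oneParticle d) (overlap d ε) μ
        (fun z => Complex.exp ((H z / √μ : ℝ) * Complex.I)) / partFun d ε μ *
        Complex.exp (-(κ * Complex.I)) := by
    have : ∀ ω, Complex.exp (fluct d ε μ H ω * Complex.I) =
        (∏ i, Complex.exp ((H (ω.2 i) / √μ : ℝ) * Complex.I)) * Complex.exp (-(κ * Complex.I)) := by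
      intro ω
      rw [hfl, ← Complex.exp_sum, ← Complex.exp_add, ← Finset.sum_mul, Complex.ofReal_sub,
        Complex.ofReal_sum]
      congr 1
      ring
    simp_rw [this]
    rw [integral_mul_const, integral_gcMeasure d ε hμ.le, Complex.real_smul, Complex.ofReal_inv,
      genFun, div_eq_inv_mul]
  have e2 : μ * ∫ z, (H z / √μ) ^ 2 ∂(oneParticle d) = ∫ z, H z ^ 2 * Maxw d z.2 := by
    rw [integral_oneParticle, ← integral_const_mul]
    refine integral_congr_ae (ae_of_all _ fun z => ?_)
    simp only
    rw [div_pow, hss]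
    field_simp
  rw [e1]
  rw [e2] at main
  refine main.trans (le_of_eq ?_)
  have h1 : 1 - μ * (2 * ε) ^ d ≠ 0 := by linarith
  have h2 : μ * (B / √μ) ^ 2 = B ^ 2 := by
    rw [div_pow, hss]
    field_simp
  have h3 : μ * (B / √μ) ^ 3 = B ^ 3 / √μ := by
    rw [pow_succ, ← mul_assoc, h2]
    ring
  rw [mul_add, mul_add, h3, ← mul_div_assoc, ← mul_assoc, ← mul_assoc, h2]
  ring

theorem tendsto_charFun_fluct {d : ℕ} {H : Torus d × Rd d → ℝ} (hH : Measurable H)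
    {B : ℝ} (hB : ∀ z, |H z| ≤ B) {μ : ℝ → ℝ} (hμ : Tendsto μ (𝓝[>] (0 : ℝ)) atTop)
    (hμε : Tendsto (fun ε => μ ε * ε ^ d) (𝓝[>] (0 : ℝ)) (𝓝 0)) :
    Tendsto (fun ε => ∫ ω, Complex.exp (fluct d ε (μ ε) H ω * Complex.I) ∂(gcMeasure d ε (μ ε)))
      (𝓝[>] (0 : ℝ)) (𝓝 (Complex.exp (-(∫ z, H z ^ 2 * Maxw d z.2 : ℝ) / 2))) := by
  have hδ : Tendsto (fun ε => μ ε * (2 * ε) ^ d) (𝓝[>] (0 : ℝ)) (𝓝 0) := by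
    have := hμε.const_mul (2 ^ d : ℝ)
    rw [mul_zero] at this
    refine this.congr fun ε => ?_
    rw [mul_pow]
    ring
  have hsq : Tendsto (fun ε => √(μ ε)) (𝓝[>] (0 : ℝ)) atTop := Real.tendsto_sqrt_atTop.comp hμ
  rw [tendsto_iff_norm_sub_tendsto_zero]
  have hlim : Tendsto (fun ε => B ^ 2 * (μ ε * (2 * ε) ^ d) / (1 - μ ε * (2 * ε) ^ d) +
      B ^ 3 / √(μ ε) + B ^ 2 * (μ ε * (2 * ε) ^ d)) (𝓝[>] (0 : ℝ)) (𝓝 0) := by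
    have h1 := (hδ.const_mul (B ^ 2)).div (hδ.const_sub 1) (by norm_num)
    have h2 := (tendsto_const_nhds (x := B ^ 3)).div_atTop hsq
    simpa using (h1.add h2).add (hδ.const_mul (B ^ 2))
  refine squeeze_zero' (Eventually.of_forall fun ε => norm_nonneg _) ?_ hlim
  filter_upwards [self_mem_nhdsWithin, hμ.eventually_gt_atTop 0, hsq.eventually_ge_atTop B,
    hδ.eventually_lt_const one_pos] with ε h1 h2 h3 h4
  exact norm_charFun_fluct_sub_le h1 h2 hH hB h3 h4

/-- The limiting covariance of the fluctuations of the observables `h`. -/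
def fluctCov {d p : ℕ} (h : Fin p → (Torus d × Rd d → ℝ)) : Matrix (Fin p) (Fin p) ℝ :=
  Matrix.of fun i j => ∫ z : Torus d × Rd d, h i z * h j z * Maxw d z.2

theorem sum_fluctCov {d p : ℕ} {h : Fin p → (Torus d × Rd d → ℝ)} (hh : ∀ i, Measurable (h i))
    (hB : ∀ i, ∃ B : ℝ, ∀ z, |h i z| ≤ B) (a : Fin p → ℝ) :
    ∑ i, ∑ j, a i * a j * ∫ z : Torus d × Rd d, h i z * h j z * Maxw d z.2 =
      ∫ z : Torus d × Rd d, (∑ i, a i * h i z) ^ 2 * Maxw d z.2 := by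
  have hint : ∀ i j, Integrable fun z : Torus d × Rd d => h i z * h j z * Maxw d z.2 := by
    intro i j
    obtain ⟨B, hB1⟩ := hB i
    obtain ⟨C, hC1⟩ := hB j
    have hB0 : 0 ≤ B := (abs_nonneg _).trans (hB1 (0, 0))
    refine (integrable_Maxw_snd d).bdd_mul (c := B * C)
      ((hh i).mul (hh j)).aestronglyMeasurable (ae_of_all _ fun z => ?_)
    rw [norm_mul]
    exact mul_le_mul (hB1 z) (hC1 z) (norm_nonneg _) hB0
  have e : ∀ z : Torus d × Rd d, (∑ i, a i * h i z) ^ 2 * Maxw d z.2 =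
      ∑ i, ∑ j, a i * a j * (h i z * h j z * Maxw d z.2) := by
    intro z
    rw [sq, Finset.sum_mul_sum, Finset.sum_mul]
    refine Finset.sum_congr rfl fun i _ => ?_
    rw [Finset.sum_mul]
    refine Finset.sum_congr rfl fun j _ => ?_
    ring
  simp_rw [e]
  rw [integral_finsetSum _ fun i _ => integrable_finsetSum _ fun j _ => (hint i j).const_mul _]
  refine Finset.sum_congr rfl fun i _ => ?_
  rw [integral_finsetSum _ fun j _ => (hint i j).const_mul _]
  exact Finset.sum_congr rfl fun j _ => (integral_const_mul _ _).symm

theorem dotProduct_fluctCov {d p : ℕ} {h : Fin p → (Torus d × Rd d → ℝ)}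
    (hh : ∀ i, Measurable (h i)) (hB : ∀ i, ∃ B : ℝ, ∀ z, |h i z| ≤ B) (a : Fin p → ℝ) :
    dotProduct a ((fluctCov h).mulVec a) =
      ∫ z : Torus d × Rd d, (∑ i, a i * h i z) ^ 2 * Maxw d z.2 := by
  rw [← sum_fluctCov hh hB]
  simp only [dotProduct, Matrix.mulVec, fluctCov, Matrix.of_apply, Finset.mul_sum]
  refine Finset.sum_congr rfl fun i _ => Finset.sum_congr rfl fun j _ => ?_
  ring

theorem posSemidef_fluctCov {d p : ℕ} {h : Fin p → (Torus d × Rd d → ℝ)}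
    (hh : ∀ i, Measurable (h i)) (hB : ∀ i, ∃ B : ℝ, ∀ z, |h i z| ≤ B) :
    (fluctCov h).PosSemidef := by
  refine Matrix.PosSemidef.of_dotProduct_mulVec_nonneg ?_ fun a => ?_
  · ext i j
    simp [fluctCov, mul_comm (h i _)]
  · rw [star_trivial, dotProduct_fluctCov hh hB]
    exact integral_nonneg fun z => mul_nonneg (sq_nonneg _) (Maxw_nonneg d _)

theorem charFun_limit {d p : ℕ} {h : Fin p → (Torus d × Rd d → ℝ)}
    (hh : ∀ i, Measurable (h i)) (hB : ∀ i, ∃ B : ℝ, ∀ z, |h i z| ≤ B)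
    (t : EuclideanSpace ℝ (Fin p)) :
    charFun (ProbabilityTheory.multivariateGaussian 0 (fluctCov h)) t =
      Complex.exp (-(∫ z : Torus d × Rd d, (∑ i, t i * h i z) ^ 2 * Maxw d z.2 : ℝ) / 2) := by
  rw [ProbabilityTheory.charFun_multivariateGaussian (posSemidef_fluctCov hh hB),
    dotProduct_fluctCov hh hB]
  simp [neg_div]

theorem map_multivariateGaussian_linear {d p : ℕ} {h : Fin p → (Torus d × Rd d → ℝ)}
    (hh : ∀ i, Measurable (h i)) (hB : ∀ i, ∃ B : ℝ, ∀ z, |h i z| ≤ B) (a : Fin p → ℝ) :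
    (ProbabilityTheory.multivariateGaussian 0 (fluctCov h)).map
        (fun x => ∑ i, a i * x i) =
      ProbabilityTheory.gaussianReal 0 (Real.toNNReal
        (∫ z : Torus d × Rd d, (∑ i, a i * h i z) ^ 2 * Maxw d z.2)) := by
  have hm : Measurable fun x : EuclideanSpace ℝ (Fin p) => ∑ i, a i * x i := by fun_prop
  have := Measure.isProbabilityMeasure_map (μ := ProbabilityTheory.multivariateGaussian 0
    (fluctCov h)) hm.aemeasurable
  refine Measure.ext_of_charFun ?_
  ext t
  have h1 : charFun ((ProbabilityTheory.multivariateGaussian 0 (fluctCov h)).map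
      (fun x => ∑ i, a i * x i)) t =
      charFun (ProbabilityTheory.multivariateGaussian 0 (fluctCov h))
        (WithLp.toLp 2 fun i => t * a i) := by
    rw [charFun_apply_real, charFun_apply, integral_map hm.aemeasurable
      (Measurable.aestronglyMeasurable (by fun_prop))]
    refine integral_congr_ae (ae_of_all _ fun x => ?_)
    simp only [PiLp.inner_apply, RCLike.inner_apply, conj_trivial]
    rw [← Complex.ofReal_mul, Finset.mul_sum]
    simp_rw [mul_assoc]
  rw [h1, charFun_limit hh hB, ProbabilityTheory.charFun_gaussianReal]
  have h2 : ∫ z : Torus d × Rd d, (∑ i, t * a i * h i z) ^ 2 * Maxw d z.2 =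
      t ^ 2 * ∫ z : Torus d × Rd d, (∑ i, a i * h i z) ^ 2 * Maxw d z.2 := by
    rw [← integral_const_mul]
    refine integral_congr_ae (ae_of_all _ fun z => ?_)
    simp only [mul_assoc]
    rw [← Finset.mul_sum]
    ring
  have h3 : 0 ≤ ∫ z : Torus d × Rd d, (∑ i, a i * h i z) ^ 2 * Maxw d z.2 :=
    integral_nonneg fun z => mul_nonneg (sq_nonneg _) (Maxw_nonneg d _)
  simp only [h2, Real.coe_toNNReal _ h3]
  push_cast
  ring_nf

/-- The vector of fluctuations of the observables `h`. -/
def fluctVec {d p : ℕ} (ε μ : ℝ) (h : Fin p → (Torus d × Rd d → ℝ)) (ω : Phase d) :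
    EuclideanSpace ℝ (Fin p) :=
  WithLp.toLp 2 fun i => fluct d ε μ (h i) ω

theorem measurable_fluctVec {d p : ℕ} (ε μ : ℝ) {h : Fin p → (Torus d × Rd d → ℝ)}
    (hh : ∀ i, Measurable (h i)) : Measurable (fluctVec ε μ h) := by
  have h1 := fun i => measurable_fluct ε μ (hh i)
  unfold fluctVec
  fun_prop

theorem charFun_map_fluctVec {d p : ℕ} (ε : ℝ) {μ : ℝ} (hμ : 0 ≤ μ)
    {h : Fin p → (Torus d × Rd d → ℝ)}
    (hh : ∀ i, Measurable (h i)) (hB : ∀ i, ∃ B : ℝ, ∀ z, |h i z| ≤ B)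
    (t : EuclideanSpace ℝ (Fin p)) :
    charFun ((gcMeasure d ε μ).map (fluctVec ε μ h)) t =
      ∫ ω, Complex.exp (fluct d ε μ (fun z => ∑ i, t i * h i z) ω * Complex.I)
        ∂(gcMeasure d ε μ) := by
  rw [charFun_apply, integral_map (measurable_fluctVec ε μ hh).aemeasurable
    (Measurable.aestronglyMeasurable (by fun_prop))]
  refine integral_congr_ae (ae_of_all _ fun ω => ?_)
  simp only [← fluct_sum ε hμ hh hB]
  simp [PiLp.inner_apply, fluctVec]

/-- The law of the vector of fluctuations (a point mass for negative activities). -/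
def fluctLaw {d p : ℕ} (ε μ : ℝ) {h : Fin p → (Torus d × Rd d → ℝ)}
    (hh : ∀ i, Measurable (h i)) : ProbabilityMeasure (EuclideanSpace ℝ (Fin p)) :=
  ⟨if 0 ≤ μ then (gcMeasure d ε μ).map (fluctVec ε μ h) else Measure.dirac 0, by
    split_ifs with hμ
    · have := isProbabilityMeasure_gcMeasure d ε hμ
      exact Measure.isProbabilityMeasure_map (measurable_fluctVec ε μ hh).aemeasurable
    · infer_instance⟩

theorem coe_fluctLaw {d p : ℕ} (ε : ℝ) {μ : ℝ} (hμ : 0 ≤ μ) {h : Fin p → (Torus d × Rd d → ℝ)}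
    (hh : ∀ i, Measurable (h i)) :
    (fluctLaw ε μ hh : Measure (EuclideanSpace ℝ (Fin p))) =
      (gcMeasure d ε μ).map (fluctVec ε μ h) :=
  if_pos hμ

theorem tendsto_fluctLaw {d p : ℕ} {h : Fin p → (Torus d × Rd d → ℝ)}
    (hh : ∀ i, Measurable (h i)) (hB : ∀ i, ∃ B : ℝ, ∀ z, |h i z| ≤ B)
    {μ : ℝ → ℝ} (hμ : Tendsto μ (𝓝[>] (0 : ℝ)) atTop)
    (hμε : Tendsto (fun ε => μ ε * ε ^ d) (𝓝[>] (0 : ℝ)) (𝓝 0)) :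
    Tendsto (fun ε => fluctLaw ε (μ ε) hh) (𝓝[>] (0 : ℝ))
      (𝓝 ⟨ProbabilityTheory.multivariateGaussian 0 (fluctCov h), inferInstance⟩) := by
  refine tendsto_of_seq_tendsto fun u hu => ?_
  refine ProbabilityMeasure.tendsto_of_tendsto_charFun fun t => ?_
  have hB₂ := hB
  choose B hB' using hB₂
  have hH : ∀ z, |∑ i, t i * h i z| ≤ ∑ i, |t i| * B i := fun z =>
    (Finset.abs_sum_le_sum_abs _ _).trans (Finset.sum_le_sum fun i _ => by
      rw [abs_mul]
      exact mul_le_mul_of_nonneg_left (hB' i z) (abs_nonneg _))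
  have key := (tendsto_charFun_fluct (H := fun z => ∑ i, t i * h i z)
    (by fun_prop) hH hμ hμε).comp hu
  change Tendsto _ _ (𝓝 (charFun (ProbabilityTheory.multivariateGaussian 0 (fluctCov h)) t))
  rw [charFun_limit hh hB]
  refine key.congr' ?_
  filter_upwards [hu.eventually (hμ.eventually_ge_atTop 0)] with n hn
  rw [Function.comp_apply, Function.comp_apply, coe_fluctLaw _ hn, charFun_map_fluctVec _ hn hh hB]

end HardSpheres

noncomputable section

/-- central limit theorem for the fluctuation field: for bounded
continuous `h₁, …, h_p`, the vector `(ζ(h₁), …, ζ(h_p))` converges in distribution,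
along any family `μ_ε → ∞` with `μ_ε ε^d → 0`, to a centered Gaussian vector with
covariance `Σ_{ij} = ∫ h_i h_j M dx dv`.  The limiting Gaussian law `G` is
characterized by the fact that each linear functional `x ↦ Σ_i a_i x_i` has law
`gaussianReal 0 (Σ_{ij} a_i a_j Σ_{ij})`; convergence in distribution is expressed
by testing against bounded continuous functions. -/
theorem fluct_CLT (d : ℕ) (hd : 1 ≤ d) (p : ℕ) (hp : 1 ≤ p)
    (h : Fin p → (Torus d × Rd d → ℝ))
    (hcont : ∀ i, Continuous (h i)) (hbdd : ∀ i, ∃ B : ℝ, ∀ z, |h i z| ≤ B)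
    (μ : ℝ → ℝ)
    (hμ : Tendsto μ (𝓝[>] (0 : ℝ)) atTop)
    (hμε : Tendsto (fun ε => μ ε * ε ^ d) (𝓝[>] (0 : ℝ)) (𝓝 0)) :
    ∃ G : Measure (Fin p → ℝ), IsProbabilityMeasure G ∧
      (∀ a : Fin p → ℝ,
        G.map (fun x => ∑ i, a i * x i) =
          ProbabilityTheory.gaussianReal 0
            (Real.toNNReal (∑ i, ∑ j, a i * a j *
              ∫ z : Torus d × Rd d, h i z * h j z * Maxw d z.2))) ∧
      (∀ f : BoundedContinuousFunction (Fin p → ℝ) ℝ,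
        Tendsto
          (fun ε => ∫ ω, f (fun i => fluct d ε (μ ε) (h i) ω) ∂(gcMeasure d ε (μ ε)))
          (𝓝[>] (0 : ℝ)) (𝓝 (∫ x, f x ∂G))) := by
  have hh : ∀ i, Measurable (h i) := fun i => (hcont i).measurable
  have hm : Measurable (WithLp.ofLp : EuclideanSpace ℝ (Fin p) → Fin p → ℝ) := by fun_prop
  refine ⟨(ProbabilityTheory.multivariateGaussian 0 (fluctCov h)).map WithLp.ofLp,
    Measure.isProbabilityMeasure_map hm.aemeasurable, fun a => ?_, fun f => ?_⟩
  · rw [Measure.map_map (by fun_prop) hm, sum_fluctCov hh hbdd]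
    exact map_multivariateGaussian_linear hh hbdd a
  · have hc : Continuous (WithLp.ofLp : EuclideanSpace ℝ (Fin p) → Fin p → ℝ) := by fun_prop
    have key := ProbabilityMeasure.tendsto_iff_forall_integral_tendsto.1
      (tendsto_fluctLaw hh hbdd hμ hμε) (f.compContinuous ⟨_, hc⟩)
    rw [integral_map hm.aemeasurable f.continuous.measurable.aestronglyMeasurable]
    refine key.congr' ?_
    filter_upwards [hμ.eventually_ge_atTop 0] with ε hε
    rw [coe_fluctLaw ε hε, integral_map (measurable_fluctVec ε _ hh).aemeasurable
      (BoundedContinuousFunction.continuous _).measurable.aestronglyMeasurable]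
    rfl

end
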